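/- arXiv:1610.01751 — 5 statements merged into one kernel-verified Lean document; each statement's English description precedes it below -/
import Mathlib

section
/- There exists a universal constant c ∈ (0,1) with the following property. Let n ≥ 8, let M be a random n×n real matrix with zero diagonal, and let σ be a uniform random permutation of {1,…,n} independent of M. Let 𝓔 be a measurable event such that the conditional probability P(𝓔 | M) ≥ 1 − c almost everywhere. Let T be the ⌊n/2⌋×⌊n/2⌋ top right corner of σ(M). Then for every τ > 0, P{‖M‖ ≥ τ} ≤ (1/c) · P{‖T‖ ≥ c·τ and 𝓔 holds}. -/
open MeasureTheory ProbabilityTheory Matrix Finset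
open scoped ENNReal

/-- The spectral norm (ℓ₂ → ℓ₂ operator norm) of a real matrix. -/
noncomputable def specNorm {m n : ℕ} (A : Matrix (Fin m) (Fin n) ℝ) : ℝ :=
  ‖LinearMap.toContinuousLinearMap (Matrix.toEuclideanLin A)‖

/-- The ⌊n/2⌋ × ⌊n/2⌋ top right corner of an n × n matrix. -/
def corner {n : ℕ} (B : Matrix (Fin n) (Fin n) ℝ) :
    Matrix (Fin (n / 2)) (Fin (n / 2)) ℝ :=
  fun i j => B ⟨i.1, lt_of_lt_of_le i.2 (Nat.div_le_self n 2)⟩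
    ⟨n - n / 2 + j.1, by have := j.2; omega⟩

noncomputable instance matrixMeasurableSpace {n : ℕ} :
    MeasurableSpace (Matrix (Fin n) (Fin n) ℝ) := MeasurableSpace.pi

instance permMeasurableSpace {n : ℕ} : MeasurableSpace (Equiv.Perm (Fin n)) := ⊤

section Deterministic

open scoped Matrix.Norms.L2Operator

theorem specNorm_eq_l2_opNorm {m n : ℕ} (A : Matrix (Fin m) (Fin n) ℝ) : specNorm A = ‖A‖ := rfl

/-- The matrix whose columns are the standard basis vectors indexed by `f`. -/
def selectionMatrix {k n : ℕ} (f : Fin k → Fin n) : Matrix (Fin n) (Fin k) ℝ :=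
  fun i a => if f a = i then 1 else 0

theorem selectionMatrix_norm_le_one {k n : ℕ} {f : Fin k → Fin n} (hf : Function.Injective f) :
    ‖selectionMatrix f‖ ≤ 1 := by
  have h : (selectionMatrix f)ᴴ * selectionMatrix f = 1 := by
    ext a b
    simp [Matrix.mul_apply, selectionMatrix, Matrix.one_apply, hf.eq_iff, eq_comm]
  have h1 : ‖(1 : Matrix (Fin k) (Fin k) ℝ)‖ ≤ 1 := by
    rw [← Matrix.diagonal_one, Matrix.l2_opNorm_diagonal]
    exact (pi_norm_le_iff_of_nonneg zero_le_one).2 fun _ => by simp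
  have h2 := Matrix.l2_opNorm_conjTranspose_mul_self (selectionMatrix f)
  rw [h] at h2
  nlinarith [norm_nonneg (selectionMatrix f)]

theorem norm_mul_mul_le_of_le_one {k l m n : ℕ} (A : Matrix (Fin k) (Fin l) ℝ)
    (B : Matrix (Fin l) (Fin m) ℝ) (C : Matrix (Fin m) (Fin n) ℝ) (hA : ‖A‖ ≤ 1) (hC : ‖C‖ ≤ 1) :
    ‖A * B * C‖ ≤ ‖B‖ :=
  calc ‖A * B * C‖ ≤ ‖A * B‖ * ‖C‖ := Matrix.l2_opNorm_mul _ _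
    _ ≤ ‖A‖ * ‖B‖ * ‖C‖ := by gcongr; exact Matrix.l2_opNorm_mul _ _
    _ ≤ 1 * ‖B‖ * 1 := by gcongr
    _ = ‖B‖ := by ring

theorem norm_submatrix_le {k n : ℕ} (A : Matrix (Fin n) (Fin n) ℝ) {f g : Fin k → Fin n}
    (hf : Function.Injective f) (hg : Function.Injective g) : ‖A.submatrix f g‖ ≤ ‖A‖ := by
  have h : A.submatrix f g = (selectionMatrix f)ᴴ * A * selectionMatrix g := by
    ext a b
    simp [Matrix.mul_apply, selectionMatrix]
  rw [h]
  refine norm_mul_mul_le_of_le_one _ _ _ ?_ (selectionMatrix_norm_le_one hg)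
  rw [Matrix.l2_opNorm_conjTranspose]
  exact selectionMatrix_norm_le_one hf

/-- Extension by zero of the submatrix with rows `f` and columns `g`. -/
def paddedSubmatrix {k n : ℕ} (A : Matrix (Fin n) (Fin n) ℝ) (f g : Fin k → Fin n) :
    Matrix (Fin n) (Fin n) ℝ :=
  selectionMatrix f * A.submatrix f g * (selectionMatrix g)ᴴ

theorem norm_paddedSubmatrix_le {k n : ℕ} (A : Matrix (Fin n) (Fin n) ℝ) {f g : Fin k → Fin n}
    (hf : Function.Injective f) (hg : Function.Injective g) :
    ‖paddedSubmatrix A f g‖ ≤ ‖A.submatrix f g‖ := by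
  refine norm_mul_mul_le_of_le_one _ _ _ (selectionMatrix_norm_le_one hf) ?_
  rw [Matrix.l2_opNorm_conjTranspose]
  exact selectionMatrix_norm_le_one hg

theorem paddedSubmatrix_apply {k n : ℕ} (A : Matrix (Fin n) (Fin n) ℝ) (f g : Fin k → Fin n)
    (i j : Fin n) :
    paddedSubmatrix A f g i j = ∑ a, ∑ b, if f a = i ∧ g b = j then A i j else 0 := by
  simp only [paddedSubmatrix, Matrix.mul_apply, selectionMatrix, Matrix.conjTranspose_apply,
    Matrix.submatrix_apply, Finset.sum_mul]
  rw [Finset.sum_comm]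
  refine Finset.sum_congr rfl fun a _ => Finset.sum_congr rfl fun b _ => ?_
  by_cases h1 : f a = i <;> by_cases h2 : g b = j <;> simp [h1, h2]

/-- The number of permutations with two prescribed values. -/
theorem card_perm_two_values {n : ℕ} {x y i j : Fin n} (hxy : x ≠ y) (hij : i ≠ j) :
    n * (n - 1) * #{π : Equiv.Perm (Fin n) | π x = i ∧ π y = j} =
      Fintype.card (Equiv.Perm (Fin n)) := by
  have key : ∀ p ∈ (Finset.univ : Finset (Fin n)).offDiag,
      #{π : Equiv.Perm (Fin n) | (π x, π y) = p} =
        #{π : Equiv.Perm (Fin n) | π x = i ∧ π y = j} := by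
    rintro ⟨i', j'⟩ hp
    have hp' : i' ≠ j' := by simpa using hp
    obtain ⟨ρ, h1, h2⟩ : ∃ ρ : Equiv.Perm (Fin n), ρ i' = i ∧ ρ j' = j := by
      have := (MulAction.is_two_pretransitive_iff (G := Equiv.Perm (Fin n)) (α := Fin n)).1
        (Equiv.Perm.isMultiplyPretransitive _ 2) hp' hij
      simpa using this
    refine Finset.card_bij (fun π _ => ρ * π) ?_ ?_ ?_
    · intro π hπ
      simp only [Finset.mem_filter, Finset.mem_univ, true_and, Prod.mk.injEq] at hπ
      simp [hπ.1, hπ.2, h1, h2]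
    · intro _ _ _ _ h
      exact mul_left_cancel h
    · intro π hπ
      simp only [Finset.mem_filter, Finset.mem_univ, true_and] at hπ
      refine ⟨ρ⁻¹ * π, ?_, by simp⟩
      simp [hπ.1, hπ.2, ← h1, ← h2]
  have hmap : ∀ π ∈ (Finset.univ : Finset (Equiv.Perm (Fin n))),
      (π x, π y) ∈ (Finset.univ : Finset (Fin n)).offDiag := by
    intro π _
    simpa using hxy
  rw [← Finset.card_univ, Finset.card_eq_sum_card_fiberwise hmap, Finset.sum_congr rfl key,
    Finset.sum_const, Finset.offDiag_card, smul_eq_mul, Finset.card_univ, Fintype.card_fin,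
    Nat.mul_sub_one]

theorem sum_paddedSubmatrix {k n : ℕ} (A : Matrix (Fin n) (Fin n) ℝ) (hA : ∀ i, A i i = 0)
    (f g : Fin k → Fin n) (hfg : ∀ a b, f a ≠ g b) :
    ((n : ℝ) * (n - 1)) • ∑ π : Equiv.Perm (Fin n), paddedSubmatrix A (π ∘ f) (π ∘ g) =
      ((k : ℝ) ^ 2 * Fintype.card (Equiv.Perm (Fin n))) • A := by
  ext i j
  rw [Matrix.smul_apply, Matrix.smul_apply, Matrix.sum_apply]
  simp only [paddedSubmatrix_apply, Function.comp_apply]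
  by_cases hij : i = j
  · subst hij
    simp [hA]
  have hn : 1 ≤ n := i.pos
  rw [Finset.sum_comm]
  simp_rw [Finset.sum_comm (s := (Finset.univ : Finset (Equiv.Perm (Fin n))))]
  have h : ∀ a b, (n : ℝ) * (n - 1) *
      ∑ π : Equiv.Perm (Fin n), (if π (f a) = i ∧ π (g b) = j then A i j else 0) =
        Fintype.card (Equiv.Perm (Fin n)) * A i j := by
    intro a b
    rw [← Finset.sum_filter, Finset.sum_const, nsmul_eq_mul,
      ← card_perm_two_values (hfg a b) hij]
    push_cast [hn]
    ring
  simp only [smul_eq_mul, Finset.mul_sum] at h ⊢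
  simp only [h, Finset.sum_const, Finset.card_univ, Fintype.card_fin, nsmul_eq_mul]
  ring

theorem corner_submatrix {n : ℕ} (A : Matrix (Fin n) (Fin n) ℝ) (π : Equiv.Perm (Fin n)) :
    corner (A.submatrix π π) = A.submatrix
      (π ∘ fun a : Fin (n / 2) => ⟨a.1, lt_of_lt_of_le a.2 (Nat.div_le_self n 2)⟩)
      (π ∘ fun b : Fin (n / 2) => ⟨n - n / 2 + b.1, by have := b.2; omega⟩) := rfl

theorem specNorm_corner_submatrix_le {n : ℕ} (A : Matrix (Fin n) (Fin n) ℝ)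
    (π : Equiv.Perm (Fin n)) : specNorm (corner (A.submatrix π π)) ≤ specNorm A := by
  rw [corner_submatrix]
  refine norm_submatrix_le A (π.injective.comp ?_) (π.injective.comp ?_)
  · intro a b h
    simpa [Fin.ext_iff] using h
  · intro a b h
    simpa [Fin.ext_iff] using h

/-- The average norm of the corner is at least `2 / 9` of the norm of the matrix. -/
theorem sum_specNorm_corner_ge {n : ℕ} (hn : 8 ≤ n) (A : Matrix (Fin n) (Fin n) ℝ)
    (hA : ∀ i, A i i = 0) :
    2 / 9 * Fintype.card (Equiv.Perm (Fin n)) * specNorm A ≤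
      ∑ π : Equiv.Perm (Fin n), specNorm (corner (A.submatrix π π)) := by
  set f : Fin (n / 2) → Fin n :=
    fun a => ⟨a.1, lt_of_lt_of_le a.2 (Nat.div_le_self n 2)⟩ with hf
  set g : Fin (n / 2) → Fin n := fun b => ⟨n - n / 2 + b.1, by have := b.2; omega⟩ with hg
  have hfi : Function.Injective f := fun a b h => by simpa [hf, Fin.ext_iff] using h
  have hgi : Function.Injective g := fun a b h => by simpa [hg, Fin.ext_iff] using h
  have hfg : ∀ a b, f a ≠ g b := by
    intro a b h
    simp only [hf, hg, Fin.mk.injEq] at h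
    omega
  have hn1 : (8 : ℝ) ≤ n := by exact_mod_cast hn
  have hpos : (0 : ℝ) < n * (n - 1) := by nlinarith
  have hle : ‖∑ π : Equiv.Perm (Fin n), paddedSubmatrix A (π ∘ f) (π ∘ g)‖ ≤
      ∑ π : Equiv.Perm (Fin n), specNorm (corner (A.submatrix π π)) :=
    (norm_sum_le _ _).trans <| Finset.sum_le_sum fun π _ =>
      norm_paddedSubmatrix_le A (π.injective.comp hfi) (π.injective.comp hgi)
  have hnorm := congrArg norm (sum_paddedSubmatrix A hA f g hfg)
  rw [norm_smul, norm_smul, Real.norm_of_nonneg hpos.le, Real.norm_of_nonneg (by positivity)]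
    at hnorm
  have hratio : 2 / 9 * ((n : ℝ) * (n - 1)) ≤ ((n / 2 : ℕ) : ℝ) ^ 2 := by
    have h4 : (4 : ℝ) ≤ ((n / 2 : ℕ) : ℝ) := by exact_mod_cast (by omega : 4 ≤ n / 2)
    have h2 : (n : ℝ) ≤ 2 * ((n / 2 : ℕ) : ℝ) + 1 := by
      exact_mod_cast (by omega : n ≤ 2 * (n / 2) + 1)
    nlinarith
  rw [specNorm_eq_l2_opNorm]
  refine le_of_mul_le_mul_left ?_ hpos
  calc (n : ℝ) * (n - 1) * (2 / 9 * Fintype.card (Equiv.Perm (Fin n)) * ‖A‖)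
      = 2 / 9 * ((n : ℝ) * (n - 1)) * Fintype.card (Equiv.Perm (Fin n)) * ‖A‖ := by ring
    _ ≤ ((n / 2 : ℕ) : ℝ) ^ 2 * Fintype.card (Equiv.Perm (Fin n)) * ‖A‖ := by gcongr
    _ = _ := hnorm.symm
    _ ≤ _ := by gcongr

theorem card_specNorm_corner_ge {n : ℕ} (hn : 8 ≤ n) (A : Matrix (Fin n) (Fin n) ℝ)
    (hA : ∀ i, A i i = 0) {τ : ℝ} (hτ : 0 < τ) (hAτ : τ ≤ specNorm A) :
    1 / 9 * (Fintype.card (Equiv.Perm (Fin n)) : ℝ) ≤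
      #{π : Equiv.Perm (Fin n) | 1 / 18 * τ ≤ specNorm (corner (A.submatrix π π))} := by
  have hpos : 0 < specNorm A := hτ.trans_le hAτ
  have hpt : ∀ π : Equiv.Perm (Fin n), specNorm (corner (A.submatrix π π)) ≤
      (if 1 / 18 * τ ≤ specNorm (corner (A.submatrix π π)) then specNorm A else 0) +
        1 / 18 * specNorm A := by
    intro π
    split_ifs with h
    · linarith [specNorm_corner_submatrix_le A π]
    · linarith
  have hsum := (sum_specNorm_corner_ge hn A hA).trans (Finset.sum_le_sum fun π _ => hpt π)
  rw [Finset.sum_add_distrib, ← Finset.sum_filter, Finset.sum_const, Finset.sum_const,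
    nsmul_eq_mul, nsmul_eq_mul, Finset.card_univ] at hsum
  have hc : (0 : ℝ) ≤ Fintype.card (Equiv.Perm (Fin n)) := Nat.cast_nonneg _
  refine le_of_mul_le_mul_right ?_ hpos
  nlinarith [mul_nonneg hc hpos.le]

end Deterministic

theorem measurable_specNorm {m n : ℕ} :
    Measurable fun A : Fin m → Fin n → ℝ => specNorm (Matrix.of A) := by
  refine Continuous.measurable (continuous_norm.comp ?_)
  exact LinearMap.continuous_of_finiteDimensional
    (((Matrix.ofLinearEquiv ℝ).trans (Matrix.toEuclideanLin.trans
      LinearMap.toContinuousLinearMap)).toLinearMap :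
        (Fin m → Fin n → ℝ) →ₗ[ℝ] EuclideanSpace ℝ (Fin n) →L[ℝ] EuclideanSpace ℝ (Fin m))

theorem measurable_specNorm_corner_submatrix {n : ℕ} (π : Equiv.Perm (Fin n)) :
    Measurable fun A : Matrix (Fin n) (Fin n) ℝ => specNorm (corner (A.submatrix π π)) := by
  refine measurable_specNorm.comp
    (measurable_pi_lambda _ fun i => measurable_pi_lambda _ fun j => ?_)
  exact (measurable_pi_apply _).comp (measurable_pi_apply _)

/-- If every point of `A` lies in at least `a * N` of the sets `B π`, then `σ` uniform over
`N` values and independent of `A` and the sets `B π` gives `a * μ A ≤ μ (A ∩ {ω | ω ∈ B (σ ω)})`. -/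
theorem ofReal_mul_measure_le_of_card_ge {Ω ι : Type*} [MeasurableSpace Ω] (μ : Measure Ω)
    [Fintype ι] [Nonempty ι] (σ : Ω → ι) (hσ : ∀ π, MeasurableSet {ω | σ ω = π})
    (A : Set Ω) (B : ι → Set Ω) (hA : MeasurableSet A) (hB : ∀ π, MeasurableSet (B π))
    (hind : ∀ π, μ (A ∩ B π ∩ {ω | σ ω = π}) = μ (A ∩ B π) * (Fintype.card ι : ℝ≥0∞)⁻¹)
    (a : ℝ) [∀ ω, DecidablePred fun π => ω ∈ B π]
    (hcard : ∀ ω ∈ A, a * Fintype.card ι ≤ #{π : ι | ω ∈ B π}) :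
    ENNReal.ofReal a * μ A ≤ μ (A ∩ {ω | ω ∈ B (σ ω)}) := by
  have hN : (Fintype.card ι : ℝ≥0∞) ≠ 0 := by simp
  have hN' : (Fintype.card ι : ℝ≥0∞) ≠ ∞ := ENNReal.natCast_ne_top _
  have hun : A ∩ {ω | ω ∈ B (σ ω)} = ⋃ π, A ∩ B π ∩ {ω | σ ω = π} := by
    ext ω
    simp
  have hcount : ENNReal.ofReal a * Fintype.card ι * μ A ≤ ∑ π, μ (A ∩ B π) := by
    calc ENNReal.ofReal a * Fintype.card ι * μ A
        = ∫⁻ _ in A, ENNReal.ofReal a * Fintype.card ι ∂μ := by simp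
      _ ≤ ∫⁻ ω in A, ∑ π, (B π).indicator 1 ω ∂μ := by
          refine setLIntegral_mono' hA fun ω hω => ?_
          have h : ∑ π, (B π).indicator (1 : Ω → ℝ≥0∞) ω = (#{π : ι | ω ∈ B π} : ℝ≥0∞) := by
            simp [Set.indicator_apply]
          rw [h, ← ENNReal.ofReal_natCast, ← ENNReal.ofReal_natCast,
            ← ENNReal.ofReal_mul' (Nat.cast_nonneg _)]
          exact ENNReal.ofReal_le_ofReal (hcard ω hω)
      _ = ∑ π, μ (A ∩ B π) := by
          rw [lintegral_finsetSum _ fun π _ => measurable_one.indicator (hB π)]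
          refine Finset.sum_congr rfl fun π _ => ?_
          rw [lintegral_indicator_one (hB π), Measure.restrict_apply (hB π), Set.inter_comm]
  rw [hun, measure_iUnion ?_ fun π => (hA.inter (hB π)).inter (hσ π), tsum_fintype]
  · simp_rw [hind]
    rw [← Finset.sum_mul]
    calc ENNReal.ofReal a * μ A
        = ENNReal.ofReal a * Fintype.card ι * μ A * (Fintype.card ι : ℝ≥0∞)⁻¹ := by
          rw [mul_right_comm, mul_assoc (ENNReal.ofReal a),
            ENNReal.mul_inv_cancel hN hN', mul_one]
      _ ≤ _ := by gcongr
  · intro π ρ hne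
    refine Set.disjoint_left.2 fun ω h1 h2 => hne ?_
    exact h1.2.symm.trans h2.2

theorem measureReal_inter_ge_of_condExp_ge {Ω : Type*} {m m0 : MeasurableSpace Ω} (μ : Measure Ω)
    [IsProbabilityMeasure μ] (hm : m ≤ m0) {E A : Set Ω} (hE : MeasurableSet E)
    (hA : MeasurableSet[m] A) {a : ℝ}
    (h : ∀ᵐ ω ∂μ, a ≤ (μ[E.indicator (fun _ => (1 : ℝ)) | m]) ω) :
    a * μ.real A ≤ μ.real (A ∩ E) := by
  have hint : Integrable (E.indicator fun _ => (1 : ℝ)) μ :=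
    (integrable_const 1).indicator hE
  have h1 := setIntegral_condExp hm hint hA
  rw [setIntegral_indicator hE] at h1
  have h2 : ∫ _ in A, a ∂μ ≤ ∫ ω in A, (μ[E.indicator (fun _ => (1 : ℝ)) | m]) ω ∂μ :=
    integral_mono_ae (integrable_const _) integrable_condExp.integrableOn (ae_restrict_of_ae h)
  rw [h1] at h2
  simpa [mul_comm] using h2

/-- **Theorem 1.** There is a universal constant `c ∈ (0,1)` such that for any `n ≥ 8`,
any random `n × n` matrix `M` with zero diagonal, any uniform random permutation `σ`
independent of `M`, and any event `E` with `P(E | M) ≥ 1 - c` a.e., one has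
`P{‖M‖ ≥ τ} ≤ (1/c) · P{‖T‖ ≥ cτ and E}`, where `T` is the top right
`⌊n/2⌋ × ⌊n/2⌋` corner of `σ(M)`. -/
theorem stmt_0 :
    ∃ c : ℝ, 0 < c ∧ c < 1 ∧
      ∀ (n : ℕ), 8 ≤ n →
      ∀ (Ω : Type) (_ : MeasurableSpace Ω) (μ : Measure Ω), IsProbabilityMeasure μ →
      ∀ (M : Ω → Matrix (Fin n) (Fin n) ℝ) (σ : Ω → Equiv.Perm (Fin n)),
        Measurable M →
        (∀ ω i, M ω i i = 0) →
        Measurable σ →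
        -- σ is uniformly distributed on the permutation group
        (∀ π : Equiv.Perm (Fin n),
          μ {ω | σ ω = π} = ((Fintype.card (Equiv.Perm (Fin n)) : ℝ≥0∞))⁻¹) →
        -- σ is independent of M
        IndepFun M σ μ →
        ∀ E : Set Ω, MeasurableSet E →
        -- P(E | M) ≥ 1 - c almost everywhere
        (∀ᵐ ω ∂μ, 1 - c ≤
          (μ[E.indicator (fun _ => (1 : ℝ)) | MeasurableSpace.comap M inferInstance]) ω) →
        ∀ τ : ℝ, 0 < τ →
          μ {ω | τ ≤ specNorm (M ω)} ≤
            ENNReal.ofReal (1 / c) *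
              μ ({ω | c * τ ≤ specNorm (corner ((M ω).submatrix (σ ω) (σ ω)))} ∩ E) := by
  classical
  refine ⟨1 / 18, by norm_num, by norm_num, ?_⟩
  intro n hn Ω _ μ _ M σ hM hdiag hσ hunif hind E hE hcond τ hτ
  have hspec : Measurable fun A : Matrix (Fin n) (Fin n) ℝ => specNorm A := measurable_specNorm
  set A : Set Ω := {ω | τ ≤ specNorm (M ω)}
  set D : Set (Matrix (Fin n) (Fin n) ℝ) := {X | τ ≤ specNorm X}
  set F : Equiv.Perm (Fin n) → Set (Matrix (Fin n) (Fin n) ℝ) :=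
    fun π => {X | 1 / 18 * τ ≤ specNorm (corner (X.submatrix π π))}
  set B : Set Ω := {ω | 1 / 18 * τ ≤ specNorm (corner ((M ω).submatrix (σ ω) (σ ω)))}
  have hD : MeasurableSet D := measurableSet_le measurable_const hspec
  have hF : ∀ π, MeasurableSet (F π) := fun π =>
    measurableSet_le measurable_const (measurable_specNorm_corner_submatrix π)
  have hAB : ENNReal.ofReal (1 / 9) * μ A ≤ μ (A ∩ B) := by
    refine ofReal_mul_measure_le_of_card_ge μ σ (fun π => hσ (measurableSet_singleton π)) A
      (fun π => M ⁻¹' F π) (hM hD) (fun π => hM (hF π)) (fun π => ?_) (1 / 9) fun ω hω => ?_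
    · rw [← hunif π]
      exact hind.measure_inter_preimage_eq_mul (D ∩ F π) {π} (hD.inter (hF π))
        (measurableSet_singleton π)
    · convert card_specNorm_corner_ge hn (M ω) (hdiag ω) hτ hω
      rfl
  have hAE := measureReal_inter_ge_of_condExp_ge μ hM.comap_le hE (A := A) ⟨D, hD, rfl⟩ hcond
  have hABr : 1 / 9 * μ.real A ≤ μ.real (A ∩ B) := by
    have := ENNReal.toReal_mono (measure_ne_top μ _) hAB
    rwa [ENNReal.toReal_mul, ENNReal.toReal_ofReal (by norm_num)] at this
  have hsplit : μ.real (A ∩ E) + μ.real (A \ E) = μ.real A := measureReal_inter_add_sdiff hE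
  have hle : μ.real (A ∩ B) ≤ μ.real (B ∩ E) + μ.real (A \ E) := by
    refine (measureReal_mono ?_).trans (measureReal_union_le _ _)
    intro ω hω
    by_cases h : ω ∈ E
    · exact Or.inl ⟨hω.2, h⟩
    · exact Or.inr ⟨hω.1, h⟩
  have hfin : μ.real A ≤ 1 / (1 / 18) * μ.real (B ∩ E) := by linarith
  rw [← ofReal_measureReal (μ := μ) (s := A), ← ofReal_measureReal (μ := μ) (s := B ∩ E),
    ← ENNReal.ofReal_mul (by norm_num)]
  exact ENNReal.ofReal_le_ofReal hfin
end

section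
/- There exists a universal constant c ∈ (0,1) such that: if n ≥ 8, M is an n×n jointly exchangeable random matrix with zero diagonal, and T is the ⌊n/2⌋×⌊n/2⌋ top right corner of M, then for every τ > 0, P{‖M‖ ≥ τ} ≤ (1/c) · P{‖T‖ ≥ c·τ}. -/
open MeasureTheory ProbabilityTheory Matrix Finset
open scoped ENNReal

section SpectralNorm

lemma specNorm_nonneg {m n : ℕ} (A : Matrix (Fin m) (Fin n) ℝ) : 0 ≤ specNorm A :=
  norm_nonneg _

lemma dotProduct_mulVec_le_specNorm {m n : ℕ} (A : Matrix (Fin m) (Fin n) ℝ)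
    (x : Fin n → ℝ) (y : Fin m → ℝ) :
    y ⬝ᵥ A *ᵥ x ≤ specNorm A * ‖WithLp.toLp 2 x‖ * ‖WithLp.toLp 2 y‖ := by
  have h1 := (LinearMap.toContinuousLinearMap (Matrix.toEuclideanLin A)).le_opNorm
    (WithLp.toLp 2 x)
  have h2 := real_inner_le_norm (Matrix.toEuclideanLin A (WithLp.toLp 2 x)) (WithLp.toLp 2 y)
  have h3 : inner ℝ (Matrix.toEuclideanLin A (WithLp.toLp 2 x)) (WithLp.toLp 2 y)
      = y ⬝ᵥ A *ᵥ x := by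
    simp [EuclideanSpace.inner_eq_star_dotProduct]
  rw [← h3]
  exact h2.trans (mul_le_mul_of_nonneg_right h1 (norm_nonneg _))

lemma specNorm_le_of_dotProduct_le {m n : ℕ} (A : Matrix (Fin m) (Fin n) ℝ) {K : ℝ} (hK : 0 ≤ K)
    (h : ∀ (x : Fin n → ℝ) (y : Fin m → ℝ),
      y ⬝ᵥ A *ᵥ x ≤ K * ‖WithLp.toLp 2 x‖ * ‖WithLp.toLp 2 y‖) :
    specNorm A ≤ K := by
  refine ContinuousLinearMap.opNorm_le_bound _ hK fun x => ?_
  have h1 := h x.ofLp (A *ᵥ x.ofLp)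
  have h2 : (A *ᵥ x.ofLp) ⬝ᵥ A *ᵥ x.ofLp
      = ‖WithLp.toLp 2 (A *ᵥ x.ofLp)‖ * ‖WithLp.toLp 2 (A *ᵥ x.ofLp)‖ := by
    rw [← real_inner_self_eq_norm_mul_norm, EuclideanSpace.inner_eq_star_dotProduct]
    simp
  rw [h2] at h1
  change ‖WithLp.toLp 2 (A *ᵥ x.ofLp)‖ ≤ K * ‖x‖
  rcases (norm_nonneg (WithLp.toLp 2 (A *ᵥ x.ofLp))).eq_or_lt with h0 | h0
  · rw [← h0]; positivity
  · exact le_of_mul_le_mul_right h1 h0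

lemma norm_toLp_comp_le {m n : ℕ} {f : Fin m → Fin n} (hf : Function.Injective f)
    (x : Fin n → ℝ) : ‖WithLp.toLp 2 (x ∘ f)‖ ≤ ‖WithLp.toLp 2 x‖ := by
  rw [EuclideanSpace.norm_eq, EuclideanSpace.norm_eq]
  refine Real.sqrt_le_sqrt ?_
  calc ∑ i, ‖x (f i)‖ ^ 2 = ∑ j ∈ univ.map ⟨f, hf⟩, ‖x j‖ ^ 2 := by simp
    _ ≤ ∑ j, ‖x j‖ ^ 2 := sum_le_sum_of_subset_of_nonneg (subset_univ _) fun _ _ _ => by positivity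

lemma sum_extend_zero {m n : ℕ} {f : Fin m → Fin n} (hf : Function.Injective f)
    (x : Fin m → ℝ) (g : Fin n → ℝ → ℝ) (hg : ∀ i, g i 0 = 0) :
    ∑ i, g i (Function.extend f x 0 i) = ∑ j, g (f j) (x j) := by
  calc ∑ i, g i (Function.extend f x 0 i)
      = ∑ i ∈ univ.map ⟨f, hf⟩, g i (Function.extend f x 0 i) := by
        refine (sum_subset (subset_univ _) fun i _ hi => ?_).symm
        rw [Function.extend_apply', Pi.zero_apply, hg]
        simpa using hi
    _ = ∑ j, g (f j) (x j) := by simp [hf.extend_apply]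

lemma norm_toLp_extend_zero {m n : ℕ} {f : Fin m → Fin n} (hf : Function.Injective f)
    (x : Fin m → ℝ) : ‖WithLp.toLp 2 (Function.extend f x 0)‖ = ‖WithLp.toLp 2 x‖ := by
  rw [EuclideanSpace.norm_eq, EuclideanSpace.norm_eq]
  congr 1
  exact sum_extend_zero hf x (fun _ t => ‖t‖ ^ 2) (by simp)

lemma specNorm_submatrix_le {k l m n : ℕ} (A : Matrix (Fin m) (Fin n) ℝ)
    {e : Fin k → Fin m} {f : Fin l → Fin n}
    (he : Function.Injective e) (hf : Function.Injective f) :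
    specNorm (A.submatrix e f) ≤ specNorm A := by
  refine specNorm_le_of_dotProduct_le _ (specNorm_nonneg _) fun x y => ?_
  have h := dotProduct_mulVec_le_specNorm A (Function.extend f x 0) (Function.extend e y 0)
  rw [norm_toLp_extend_zero hf, norm_toLp_extend_zero he] at h
  convert h using 1
  have h1 (i : Fin m) : (A *ᵥ Function.extend f x 0) i = ∑ j, A i (f j) * x j :=
    sum_extend_zero hf x (fun j t => A i j * t) (by simp)
  simp only [dotProduct, h1]
  exact (sum_extend_zero he y (fun i t => t * ∑ j, A i (f j) * x j) (by simp)).symm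

lemma continuous_specNorm (m n : ℕ) :
    Continuous (specNorm : Matrix (Fin m) (Fin n) ℝ → ℝ) := by
  have : Continuous ((LinearMap.toContinuousLinearMap
      (𝕜 := ℝ) (E := EuclideanSpace ℝ (Fin n)) (F' := EuclideanSpace ℝ (Fin m))).toLinearMap ∘ₗ
      (Matrix.toEuclideanLin (𝕜 := ℝ) (m := Fin m) (n := Fin n)).toLinearMap) :=
    LinearMap.continuous_of_finiteDimensional _
  exact this.norm

end SpectralNorm

section Averaging

open Equiv

lemma sum_perm_apply_pair {α : Type*} [Fintype α] [DecidableEq α] (h : α → α → ℝ)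
    {u v u' v' : α} (huv : u ≠ v) (huv' : u' ≠ v') :
    ∑ σ : Perm α, h (σ u) (σ v) = ∑ σ : Perm α, h (σ u') (σ v') := by
  obtain ⟨π, hu, hv⟩ : ∃ π : Perm α, π u = u' ∧ π v = v' := by
    refine ⟨(Equiv.swap u u').trans (Equiv.swap (Equiv.swap u u' v) v'), ?_, by simp⟩
    rw [Equiv.trans_apply, Equiv.swap_apply_left]
    refine Equiv.swap_apply_of_ne_of_ne ?_ huv'
    intro hc
    apply huv
    apply (Equiv.swap u u').injective
    rw [Equiv.swap_apply_left, ← hc]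
  rw [← Equiv.sum_comp (Equiv.mulRight π)]
  simp [hu, hv]

lemma card_offDiag_mul_sum_perm {α : Type*} [Fintype α] [DecidableEq α] (h : α → α → ℝ)
    (h0 : ∀ a, h a a = 0) {u v : α} (huv : u ≠ v) :
    ((Fintype.card α : ℝ) * (Fintype.card α - 1)) * ∑ σ : Perm α, h (σ u) (σ v)
      = (Fintype.card (Perm α) : ℝ) * ∑ a, ∑ b, h a b := by
  set S := ∑ σ : Perm α, h (σ u) (σ v)
  have hS (a b : α) : ∑ σ : Perm α, h (σ a) (σ b) = S - if a = b then S else 0 := by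
    split_ifs with hab
    · simp [hab, h0]
    · rw [sub_zero]; exact sum_perm_apply_pair h hab huv
  calc ((Fintype.card α : ℝ) * (Fintype.card α - 1)) * S
      = ∑ a : α, ∑ b : α, ∑ σ : Perm α, h (σ a) (σ b) := by
        simp only [hS, sum_sub_distrib, sum_const, sum_ite_eq, mem_univ, if_true, card_univ,
          nsmul_eq_mul]
        ring
    _ = ∑ σ : Perm α, ∑ a : α, ∑ b : α, h (σ a) (σ b) := by
        rw [sum_comm (s := (univ : Finset (Perm α)))]
        exact sum_congr rfl fun a _ => sum_comm
    _ = ∑ _σ : Perm α, ∑ a, ∑ b, h a b := by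
        refine sum_congr rfl fun σ _ => ?_
        rw [← Equiv.sum_comp σ (fun a => ∑ b, h a b)]
        exact sum_congr rfl fun a _ => Equiv.sum_comp σ (h (σ a))
    _ = _ := by simp

lemma specNorm_mul_le_sum_corner {n : ℕ} (hn : 2 ≤ n) (A : Matrix (Fin n) (Fin n) ℝ)
    (h0 : ∀ i, A i i = 0) :
    ((n / 2 : ℕ) : ℝ) ^ 2 * Fintype.card (Perm (Fin n)) * specNorm A
      ≤ n * (n - 1) * ∑ σ : Perm (Fin n), specNorm (corner (A.submatrix σ σ)) := by
  have hn' : (2 : ℝ) ≤ n := by exact_mod_cast hn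
  set m := n / 2 with hm
  have hmpos : 0 < m := by omega
  set N : ℝ := (Fintype.card (Perm (Fin n)) : ℝ)
  have hN : 0 < N := by simp only [N]; exact_mod_cast Fintype.card_pos
  have hK : 0 < (m : ℝ) ^ 2 * N := by positivity
  set e : Fin m → Fin n := fun i => ⟨i.1, lt_of_lt_of_le i.2 (Nat.div_le_self n 2)⟩
  set f : Fin m → Fin n := fun j => ⟨n - n / 2 + j.1, by have := j.2; omega⟩
  have he : Function.Injective e := fun i j h => by simpa [e, Fin.ext_iff] using h
  have hf : Function.Injective f := fun i j h => by simpa [f, Fin.ext_iff] using h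
  have hef (i j) : e i ≠ f j := by
    have := i.2
    simp only [e, f, ne_eq, Fin.mk.injEq]; omega
  rw [mul_comm, ← le_div_iff₀ hK]
  have hs : 0 ≤ ∑ σ : Perm (Fin n), specNorm (corner (A.submatrix σ σ)) :=
    sum_nonneg fun _ _ => specNorm_nonneg _
  have hn1 : 0 ≤ (n : ℝ) * (n - 1) := by nlinarith
  refine specNorm_le_of_dotProduct_le _ (by positivity) fun x y => ?_
  set X := ‖WithLp.toLp 2 x‖
  set Y := ‖WithLp.toLp 2 y‖
  have hcorner (σ : Perm (Fin n)) :
      ∑ a, ∑ b, y (σ (e a)) * (A (σ (e a)) (σ (f b)) * x (σ (f b)))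
        ≤ specNorm (corner (A.submatrix σ σ)) * X * Y := by
    have h1 := dotProduct_mulVec_le_specNorm (corner (A.submatrix σ σ))
      (x ∘ (σ ∘ f)) (y ∘ (σ ∘ e))
    have hx : ‖WithLp.toLp 2 (x ∘ (σ ∘ f))‖ ≤ X := norm_toLp_comp_le (σ.injective.comp hf) x
    have hy : ‖WithLp.toLp 2 (y ∘ (σ ∘ e))‖ ≤ Y := norm_toLp_comp_le (σ.injective.comp he) y
    have hc := specNorm_nonneg (corner (A.submatrix σ σ))
    refine le_trans (le_of_eq ?_) (h1.trans (by gcongr))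
    simp only [dotProduct, mulVec, mul_sum]
    rfl
  have havg : (n : ℝ) * (n - 1) *
      ∑ σ : Perm (Fin n), ∑ a, ∑ b, y (σ (e a)) * (A (σ (e a)) (σ (f b)) * x (σ (f b)))
      = (m : ℝ) ^ 2 * N * (y ⬝ᵥ A *ᵥ x) := by
    have hab (a b) := card_offDiag_mul_sum_perm (fun i j => y i * (A i j * x j))
      (by simp [h0]) (hef a b)
    simp only [Fintype.card_fin] at hab
    rw [sum_comm]
    simp_rw [sum_comm (s := (univ : Finset (Perm (Fin n)))), mul_sum (s := (univ : Finset (Fin m))),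
      hab]
    have hyx : y ⬝ᵥ A *ᵥ x = ∑ i, ∑ j, y i * (A i j * x j) := by
      simp only [dotProduct, mulVec, mul_sum]
    simp only [sum_const, card_univ, Fintype.card_fin, nsmul_eq_mul, hyx]
    ring
  have hsum := sum_le_sum fun σ (_ : σ ∈ (univ : Finset (Perm (Fin n)))) => hcorner σ
  have := mul_le_mul_of_nonneg_left hsum hn1
  rw [havg, ← sum_mul, ← sum_mul] at this
  rw [div_mul_eq_mul_div, div_mul_eq_mul_div, le_div_iff₀ hK]
  linarith

lemma card_perm_le_card_corner {n : ℕ} (hn : 8 ≤ n) (A : Matrix (Fin n) (Fin n) ℝ)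
    (h0 : ∀ i, A i i = 0) {τ : ℝ} (hτ : 0 < τ) (hA : τ ≤ specNorm A) :
    (Fintype.card (Perm (Fin n)) : ℝ) ≤
      10 * #{σ : Perm (Fin n) | 1 / 10 * τ ≤ specNorm (corner (A.submatrix σ σ))} := by
  have hmain := specNorm_mul_le_sum_corner (by omega) A h0
  set N : ℝ := (Fintype.card (Perm (Fin n)) : ℝ)
  have hN : 0 ≤ N := by positivity
  set s := specNorm A
  have hs : 0 < s := hτ.trans_le hA
  have hle (σ : Perm (Fin n)) : specNorm (corner (A.submatrix σ σ)) ≤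
      1 / 10 * s + if 1 / 10 * τ ≤ specNorm (corner (A.submatrix σ σ)) then s else 0 := by
    split_ifs with h
    · have h1 : specNorm (corner (A.submatrix σ σ)) ≤ s := by
        refine specNorm_submatrix_le A (σ.injective.comp ?_) (σ.injective.comp ?_) <;>
        · intro i j hij
          simpa [Fin.ext_iff] using hij
      linarith
    · linarith
  have hsum := sum_le_sum fun σ (_ : σ ∈ (univ : Finset (Perm (Fin n)))) => hle σ
  rw [sum_add_distrib, ← sum_filter] at hsum
  simp only [sum_const, card_univ, nsmul_eq_mul] at hsum
  set k : ℝ := (#{σ : Perm (Fin n) | 1 / 10 * τ ≤ specNorm (corner (A.submatrix σ σ))} : ℝ)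
  have hn' : (8 : ℝ) ≤ n := by exact_mod_cast hn
  have hm : ((n : ℝ) - 1) / 2 ≤ (n / 2 : ℕ) := by
    have : n ≤ 2 * (n / 2) + 1 := by omega
    have : (n : ℝ) ≤ 2 * (n / 2 : ℕ) + 1 := by exact_mod_cast this
    linarith
  have hm2 : (n : ℝ) * (n - 1) * (1 / 5) ≤ ((n / 2 : ℕ) : ℝ) ^ 2 := by nlinarith
  have hp : 0 < (n : ℝ) * (n - 1) := by nlinarith
  have h1 : (n : ℝ) * (n - 1) * (1 / 5 * N * s) ≤
      n * (n - 1) * (N * (1 / 10 * s) + k * s) :=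
    calc (n : ℝ) * (n - 1) * (1 / 5 * N * s) = n * (n - 1) * (1 / 5) * (N * s) := by ring
      _ ≤ ((n / 2 : ℕ) : ℝ) ^ 2 * (N * s) := by gcongr
      _ = ((n / 2 : ℕ) : ℝ) ^ 2 * N * s := by ring
      _ ≤ _ := hmain.trans (mul_le_mul_of_nonneg_left hsum hp.le)
  have h2 := le_of_mul_le_mul_left h1 hp
  have h3 : N * s ≤ 10 * k * s := by linarith
  exact le_of_mul_le_mul_right h3 hs

end Averaging

lemma measurable_specNorm_corner (n : ℕ) :
    Measurable fun A : Matrix (Fin n) (Fin n) ℝ => specNorm (corner A) := by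
  have h : Continuous fun A : Fin n → Fin n → ℝ => specNorm (corner A) := by
    refine (continuous_specNorm _ _).comp ?_
    refine continuous_pi fun i => continuous_pi fun j => ?_
    exact (continuous_apply _).comp (continuous_apply _)
  exact h.measurable

lemma measurable_specNorm_s1 (n : ℕ) :
    Measurable (specNorm : Matrix (Fin n) (Fin n) ℝ → ℝ) := by
  have h : Continuous fun A : Fin n → Fin n → ℝ => specNorm (A : Matrix (Fin n) (Fin n) ℝ) :=
    continuous_specNorm n n
  exact h.measurable

lemma measurable_submatrix {n : ℕ} (σ : Fin n → Fin n) :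
    Measurable fun A : Matrix (Fin n) (Fin n) ℝ => A.submatrix σ σ := by
  refine measurable_pi_lambda _ fun i => measurable_pi_lambda _ fun j => ?_
  exact (measurable_pi_apply (σ j)).comp (measurable_pi_apply (σ i))

/-- **Corollary.** There is a universal constant `c ∈ (0,1)` such that if `n ≥ 8`,
`M` is an `n × n` jointly exchangeable random matrix with zero diagonal and `T` is the
top right `⌊n/2⌋ × ⌊n/2⌋` corner of `M`, then
`P{‖M‖ ≥ τ} ≤ (1/c) · P{‖T‖ ≥ cτ}` for every `τ > 0`. -/
theorem stmt_1 :
    ∃ c : ℝ, 0 < c ∧ c < 1 ∧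
      ∀ (n : ℕ), 8 ≤ n →
      ∀ (Ω : Type) (_ : MeasurableSpace Ω) (μ : Measure Ω), IsProbabilityMeasure μ →
      ∀ M : Ω → Matrix (Fin n) (Fin n) ℝ,
        Measurable M →
        (∀ ω i, M ω i i = 0) →
        -- M is jointly exchangeable: M is equidistributed with σ(M) for every permutation σ
        (∀ π : Equiv.Perm (Fin n),
          Measure.map M μ = Measure.map (fun ω => (M ω).submatrix π π) μ) →
        ∀ τ : ℝ, 0 < τ →
          μ {ω | τ ≤ specNorm (M ω)} ≤
            ENNReal.ofReal (1 / c) * μ {ω | c * τ ≤ specNorm (corner (M ω))} := by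
  refine ⟨1 / 10, by norm_num, by norm_num, ?_⟩
  intro n hn Ω _ μ _ M hM hdiag hexch τ hτ
  set E : Set (Matrix (Fin n) (Fin n) ℝ) := {A | 1 / 10 * τ ≤ specNorm (corner A)} with hE
  have hEm : MeasurableSet E := measurableSet_le measurable_const (measurable_specNorm_corner n)
  have hsub (σ : Equiv.Perm (Fin n)) : Measurable fun ω => (M ω).submatrix σ σ :=
    (measurable_submatrix σ).comp hM
  set F : Equiv.Perm (Fin n) → Set Ω := fun σ => {ω | (M ω).submatrix σ σ ∈ E} with hF
  have hFm (σ) : MeasurableSet (F σ) := hsub σ hEm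
  have hFμ (σ) : μ (F σ) = μ (M ⁻¹' E) := by
    rw [← Measure.map_apply hM hEm, hexch σ, Measure.map_apply (hsub σ) hEm]
    rfl
  set N := Fintype.card (Equiv.Perm (Fin n)) with hN
  have hN0 : (N : ℝ≥0∞) ≠ 0 := by simp [hN, Fintype.card_ne_zero]
  have hpt (ω : Ω) : {ω | τ ≤ specNorm (M ω)}.indicator (fun _ => (N : ℝ≥0∞)) ω ≤
      10 * ∑ σ, (F σ).indicator 1 ω := by
    by_cases hω : τ ≤ specNorm (M ω)
    swap
    · simp [hω]
    rw [Set.indicator_of_mem (by exact hω)]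
    have h := card_perm_le_card_corner hn (M ω) (hdiag ω) hτ hω
    have h' : ∑ σ, (F σ).indicator (1 : Ω → ℝ≥0∞) ω =
        (#{σ : Equiv.Perm (Fin n) | 1 / 10 * τ ≤ specNorm (corner ((M ω).submatrix σ σ))} : ℕ) := by
      simp [Set.indicator_apply, hF, hE]
    rw [h']
    exact_mod_cast h
  have hm : MeasurableSet {ω | τ ≤ specNorm (M ω)} :=
    measurableSet_le measurable_const ((measurable_specNorm_s1 n).comp hM)
  have key : (N : ℝ≥0∞) * μ {ω | τ ≤ specNorm (M ω)} ≤ N * (10 * μ (M ⁻¹' E)) :=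
    calc (N : ℝ≥0∞) * μ {ω | τ ≤ specNorm (M ω)}
        = ∫⁻ ω, {ω | τ ≤ specNorm (M ω)}.indicator (fun _ => (N : ℝ≥0∞)) ω ∂μ := by
          rw [lintegral_indicator_const hm]
      _ ≤ ∫⁻ ω, 10 * ∑ σ, (F σ).indicator 1 ω ∂μ := lintegral_mono hpt
      _ = 10 * ∑ σ, μ (F σ) := by
          rw [lintegral_const_mul _ (Finset.measurable_fun_sum _ fun σ _ =>
            measurable_one.indicator (hFm σ)), lintegral_finsetSum _ fun σ _ =>
            measurable_one.indicator (hFm σ)]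
          simp_rw [lintegral_indicator_one (hFm _)]
      _ = N * (10 * μ (M ⁻¹' E)) := by
          simp only [hFμ, sum_const, card_univ, nsmul_eq_mul, ← hN]
          ring
  have h10 : ENNReal.ofReal (1 / (1 / 10)) = 10 := by norm_num
  rw [h10]
  exact (ENNReal.mul_le_mul_iff_right hN0 (ENNReal.natCast_ne_top N)).1 key
end

section
/- For every γ ∈ (0,1) there exists a constant C > 0 with the following property. Let A be an n×n random matrix taking values in 𝒜_n(d), and let δ > 0 be such that almost surely C·‖row_i(A)‖₂ ≤ δ and C·‖col_i(A)‖₂ ≤ δ for all i ≤ n. Let σ be a uniform random permutation of {1,…,n} independent of A, and let T_s be the ⌊n/2⌋×⌊n/2⌋ top right corner of σ(A). Let 𝓔 be the event that for all k ∈ ℕ (k ≥ 1): |{i ≤ ⌊n/2⌋ : |u_i(T_s) − d/2| > k·δ}| ≤ n·e^{−k²} and |{i ≤ ⌊n/2⌋ : |v_i(T_s) − d/2| > k·δ}| ≤ n·e^{−k²}. Then the conditional probability satisfies P(𝓔 | A) ≥ 1 − γ almost surely. -/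
open MeasureTheory ProbabilityTheory Matrix Finset
open scoped ENNReal

theorem sum_exp_signed_sum_le {ι : Type*} [Fintype ι] [DecidableEq ι] (a : ι → ℝ) (l : ℝ) :
    ∑ ε : ι → Bool, Real.exp (l * ∑ i, (if ε i then -a i else a i)) ≤
      2 ^ Fintype.card ι * Real.exp (l ^ 2 * (∑ i, a i ^ 2) / 2) := by
  have h : ∑ ε : ι → Bool, Real.exp (l * ∑ i, (if ε i then -a i else a i)) =
      ∏ i, (2 * Real.cosh (l * a i)) := by
    calc _ = ∑ ε : ι → Bool, ∏ i, Real.exp (l * if ε i then -a i else a i) := by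
          simp only [Finset.mul_sum, Real.exp_sum]
      _ = ∏ i, ∑ b : Bool, Real.exp (l * if b then -a i else a i) := by
          rw [Fintype.prod_sum]
      _ = _ := by
          refine Finset.prod_congr rfl fun i _ => ?_
          simp [Real.cosh_eq]
          ring
  rw [h, Finset.prod_mul_distrib, Finset.prod_const, Finset.card_univ, Finset.mul_sum,
    Finset.sum_div, Real.exp_sum]
  gcongr with i
  refine (Real.cosh_le_exp_half_sq _).trans_eq ?_
  ring_nf

theorem card_abs_signed_sum_gt_le {ι : Type*} [Fintype ι] [DecidableEq ι] (a : ι → ℝ)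
    {l t v : ℝ} (hl : 0 ≤ l) (hv : ∑ i, a i ^ 2 ≤ v) :
    (#{ε : ι → Bool | t < |∑ i, (if ε i then -a i else a i)|} : ℝ) ≤
      2 ^ Fintype.card ι * (2 * Real.exp (-(l * t) + l ^ 2 * v / 2)) := by
  set S : (ι → Bool) → ℝ := fun ε => ∑ i, (if ε i then -a i else a i)
  have hexp : ∀ s : ℝ, s ^ 2 = l ^ 2 → ∑ ε, Real.exp (s * S ε) ≤
      2 ^ Fintype.card ι * Real.exp (l ^ 2 * v / 2) := fun s hs => by
    refine (sum_exp_signed_sum_le a s).trans ?_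
    rw [hs]
    gcongr
  have hpt : ∀ ε, (if t < |S ε| then (1 : ℝ) else 0) ≤
      Real.exp (-(l * t)) * (Real.exp (l * S ε) + Real.exp (-l * S ε)) := fun ε => by
    split_ifs with h
    · rw [mul_add, ← Real.exp_add, ← Real.exp_add]
      rcases lt_abs.1 h with h | h
      · refine le_add_of_le_of_nonneg (Real.one_le_exp ?_) (Real.exp_nonneg _)
        nlinarith
      · refine le_add_of_nonneg_of_le (Real.exp_nonneg _) (Real.one_le_exp ?_)
        nlinarith
    · positivity
  calc (#{ε | t < |S ε|} : ℝ) = ∑ ε, if t < |S ε| then (1 : ℝ) else 0 := by simp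
    _ ≤ ∑ ε, Real.exp (-(l * t)) * (Real.exp (l * S ε) + Real.exp (-l * S ε)) :=
        Finset.sum_le_sum fun ε _ => hpt ε
    _ = Real.exp (-(l * t)) * (∑ ε, Real.exp (l * S ε) + ∑ ε, Real.exp (-l * S ε)) := by
        rw [← Finset.mul_sum, Finset.sum_add_distrib]
    _ ≤ Real.exp (-(l * t)) * (2 ^ Fintype.card ι * Real.exp (l ^ 2 * v / 2) +
          2 ^ Fintype.card ι * Real.exp (l ^ 2 * v / 2)) := by
        gcongr
        · exact hexp l rfl
        · exact hexp (-l) (by ring)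
    _ = _ := by rw [Real.exp_add]; ring

/-- The permutation of `α` that exchanges `e (i, false)` and `e (i, true)` whenever `ε i`. -/
noncomputable def pairSwap {ι α : Type*} (e : ι × Bool ↪ α) (ε : ι → Bool) : Equiv.Perm α :=
  Equiv.Perm.viaEmbedding
    (Function.Involutive.toPerm (fun x : ι × Bool => (x.1, xor x.2 (ε x.1)))
      (fun x => by simp)) e

theorem pairSwap_apply {ι α : Type*} (e : ι × Bool ↪ α) (ε : ι → Bool) (i : ι) (b : Bool) :
    pairSwap e ε (e (i, b)) = e (i, xor b (ε i)) := by
  rw [pairSwap, Equiv.Perm.viaEmbedding_apply]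
  rfl

/-- A column sum over one half of the positions is, up to `2R`, half of a signed sum. -/
theorem abs_half_column_sum_sub_le {ι α : Type*} [Fintype ι] [DecidableEq ι] [Fintype α]
    [DecidableEq α] (e : ι × Bool ↪ α) (hcard : Fintype.card α ≤ 2 * Fintype.card ι + 1)
    (x : α → ℝ) {d R : ℝ} (hx0 : ∀ a, 0 ≤ x a) (hxR : ∀ a, x a ≤ R) (hR : 0 ≤ R)
    (hd : ∑ a, x a = d) (ε : ι → Bool) (j : ι) :
    2 * |∑ i, x (e (i, Function.update ε j false i)) - d / 2| ≤
      |∑ i, (if ε i then -(if i = j then 0 else x (e (i, false)) - x (e (i, true)))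
        else (if i = j then 0 else x (e (i, false)) - x (e (i, true))))| + 2 * R := by
  set r := ∑ a ∈ (univ.map e)ᶜ, x a with hr
  have hr0 : 0 ≤ r := Finset.sum_nonneg fun a _ => hx0 a
  have hrR : r ≤ R := by
    have hc : #(univ.map e)ᶜ ≤ 1 := by
      rw [Finset.card_compl, Finset.card_map, Finset.card_univ, Fintype.card_prod,
        Fintype.card_bool]
      omega
    refine (Finset.sum_le_card_nsmul _ _ R fun a _ => hxR a).trans ?_
    rw [nsmul_eq_mul]
    have : (#(univ.map e)ᶜ : ℝ) ≤ 1 := by exact_mod_cast hc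
    nlinarith
  have hsum : ∑ i, (x (e (i, false)) + x (e (i, true))) + r = d := by
    rw [← hd, hr, ← Finset.sum_add_sum_compl (univ.map e) x, Finset.sum_map,
      Fintype.sum_prod_type]
    simp [add_comm]
  have hkey : 2 * (∑ i, x (e (i, Function.update ε j false i)) - d / 2) =
      ∑ i, (if ε i then -(if i = j then 0 else x (e (i, false)) - x (e (i, true)))
        else (if i = j then 0 else x (e (i, false)) - x (e (i, true)))) +
      (x (e (j, false)) - x (e (j, true))) - r := by
    have h1 : ∀ i, 2 * x (e (i, Function.update ε j false i)) =
        (x (e (i, false)) + x (e (i, true))) +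
        (if ε i then -(if i = j then 0 else x (e (i, false)) - x (e (i, true)))
        else (if i = j then 0 else x (e (i, false)) - x (e (i, true)))) +
        (if i = j then x (e (i, false)) - x (e (i, true)) else 0) := fun i => by
      by_cases hij : i = j
      · subst hij
        simp
        ring
      · cases h : ε i <;> simp [hij, h] <;> ring
    rw [mul_sub, Finset.mul_sum, Finset.sum_congr rfl fun i _ => h1 i, Finset.sum_add_distrib,
      Finset.sum_add_distrib, Finset.sum_ite_eq' univ j]
    simp only [Finset.mem_univ, if_true]
    linarith
  have h2 : 2 * |∑ i, x (e (i, Function.update ε j false i)) - d / 2| =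
      |2 * (∑ i, x (e (i, Function.update ε j false i)) - d / 2)| := by
    rw [abs_mul, abs_two]
  rw [h2, hkey, add_sub_assoc]
  refine (abs_add_le _ _).trans (add_le_add le_rfl ?_)
  rw [abs_le]
  constructor <;> linarith [hx0 (e (j, false)), hx0 (e (j, true)), hxR (e (j, false)),
    hxR (e (j, true))]

/-- Concentration of a column sum over one half of the positions of a randomly permuted matrix. -/
theorem card_perm_column_deviation_le {ι α : Type*} [Fintype ι] [DecidableEq ι] [Fintype α]
    [DecidableEq α] (e : ι × Bool ↪ α) (hcard : Fintype.card α ≤ 2 * Fintype.card ι + 1)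
    (M : Matrix α α ℝ) {d δ C k : ℝ} (hM0 : ∀ a c, 0 ≤ M a c) (hd : ∀ c, ∑ a, M a c = d)
    (hδ : 0 < δ) (hC : 2 ≤ C) (hM : ∀ c, C ^ 2 * ∑ a, M a c ^ 2 ≤ δ ^ 2) (hk : 1 ≤ k) (j : ι) :
    (#{σ : Equiv.Perm α |
        k * δ < |∑ i, M (σ (e (i, false))) (σ (e (j, true))) - d / 2|} : ℝ) ≤
      Fintype.card (Equiv.Perm α) * (2 * Real.exp (-(k ^ 2 * C ^ 2 / 4))) := by
  have hC0 : 0 < C := by linarith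
  set P : Equiv.Perm α → Prop := fun σ =>
    k * δ < |∑ i, M (σ (e (i, false))) (σ (e (j, true))) - d / 2| with hP
  set B : ℝ := 2 * Real.exp (-(k ^ 2 * C ^ 2 / 4)) with hB
  have hfix : ∀ σ : Equiv.Perm α,
      (#{ε : ι → Bool | P (σ * pairSwap e (Function.update ε j false))} : ℝ) ≤
        2 ^ Fintype.card ι * B := fun σ => by
    set c := σ (e (j, true)) with hc
    set x : α → ℝ := fun a => M (σ a) c with hx
    set a : ι → ℝ := fun i => if i = j then 0 else x (e (i, false)) - x (e (i, true)) with ha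
    have hx0 : ∀ b, 0 ≤ x b := fun b => hM0 _ _
    have hxd : ∑ b, x b = d := (Equiv.sum_comp σ fun b => M b c).trans (hd c)
    have hxsq : ∑ b, x b ^ 2 ≤ δ ^ 2 / C ^ 2 := by
      rw [le_div_iff₀' (by positivity)]
      exact (congrArg (C ^ 2 * ·) (Equiv.sum_comp σ fun b => M b c ^ 2)).trans_le (hM c)
    have hxR : ∀ b, x b ≤ δ / C := fun b => by
      refine (sq_le_sq₀ (hx0 b) (by positivity)).1 ?_
      rw [div_pow]
      exact (Finset.single_le_sum (f := fun b => x b ^ 2) (fun _ _ => sq_nonneg _)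
        (Finset.mem_univ b)).trans hxsq
    have hasq : ∑ i, a i ^ 2 ≤ 2 * (δ ^ 2 / C ^ 2) := by
      have h1 : ∑ i, a i ^ 2 ≤ ∑ i, 2 * (x (e (i, false)) ^ 2 + x (e (i, true)) ^ 2) := by
        refine Finset.sum_le_sum fun i _ => ?_
        simp only [ha]
        split_ifs
        · rw [zero_pow two_ne_zero]
          positivity
        · nlinarith [sq_nonneg (x (e (i, false)) + x (e (i, true)))]
      have h2 : ∑ i, (x (e (i, false)) ^ 2 + x (e (i, true)) ^ 2) ≤ ∑ b, x b ^ 2 := by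
        calc _ = ∑ b ∈ univ.map e, x b ^ 2 := by
              rw [Finset.sum_map, Fintype.sum_prod_type]
              simp [add_comm]
          _ ≤ _ := Finset.sum_le_sum_of_subset_of_nonneg (Finset.subset_univ _)
              fun _ _ _ => sq_nonneg _
      rw [← Finset.mul_sum] at h1
      linarith
    have hsub : (#{ε : ι → Bool | P (σ * pairSwap e (Function.update ε j false))} : ℝ) ≤
        #{ε : ι → Bool | k * δ < |∑ i, (if ε i then -a i else a i)|} := by
      refine Nat.cast_le.2 (Finset.card_le_card fun ε => ?_)
      simp only [Finset.mem_filter, Finset.mem_univ, true_and, hP, Equiv.Perm.mul_apply,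
        pairSwap_apply, Function.update_self, Bool.xor_false, Bool.false_xor]
      intro h
      have h3 := abs_half_column_sum_sub_le e hcard x hx0 hxR (by positivity) hxd ε j
      have h4 : δ / C ≤ δ / 2 := by gcongr
      have h5 : k * δ < |∑ i, x (e (i, Function.update ε j false i)) - d / 2| := h
      have h6 : δ ≤ k * δ := le_mul_of_one_le_left hδ.le hk
      simp only [ha]
      linarith
    refine hsub.trans ((card_abs_signed_sum_gt_le a (l := k * C ^ 2 / (2 * δ))
      (by positivity) hasq).trans_eq ?_)
    congr 3
    field_simp
    ring
  have hcount : (2 : ℝ) ^ Fintype.card ι * #{σ | P σ} =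
      ∑ σ, (#{ε : ι → Bool | P (σ * pairSwap e (Function.update ε j false))} : ℝ) := by
    simp only [Finset.card_filter, Nat.cast_sum]
    rw [Finset.sum_comm]
    have h : ∀ ε : ι → Bool,
        ∑ σ, ((if P (σ * pairSwap e (Function.update ε j false)) then 1 else 0 : ℕ) : ℝ) =
          ∑ σ, ((if P σ then 1 else 0 : ℕ) : ℝ) := fun ε =>
      Equiv.sum_comp (Equiv.mulRight (pairSwap e (Function.update ε j false)))
        fun σ => ((if P σ then 1 else 0 : ℕ) : ℝ)
    rw [Finset.sum_congr rfl fun ε _ => h ε, Finset.sum_const, Finset.card_univ, nsmul_eq_mul]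
    simp
  refine le_of_mul_le_mul_left ?_ (show (0 : ℝ) < 2 ^ Fintype.card ι by positivity)
  rw [hcount]
  refine (Finset.sum_le_sum fun σ _ => hfix σ).trans_eq ?_
  rw [Finset.sum_const, Finset.card_univ, nsmul_eq_mul]
  ring

theorem card_perm_many_deviations_le {ι α : Type*} [Fintype ι] [DecidableEq ι] [Fintype α]
    [DecidableEq α] (e : ι × Bool ↪ α) (hcard : Fintype.card α ≤ 2 * Fintype.card ι + 1)
    (M : Matrix α α ℝ) {d δ C : ℝ} (hM0 : ∀ a c, 0 ≤ M a c) (hd : ∀ c, ∑ a, M a c = d)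
    (hδ : 0 < δ) (hC : 2 ≤ C) (hM : ∀ c, C ^ 2 * ∑ a, M a c ^ 2 ≤ δ ^ 2) {k : ℕ} (hk : 1 ≤ k) :
    (#{σ : Equiv.Perm α | Fintype.card α * Real.exp (-(k : ℝ) ^ 2) <
        #{j | k * δ < |∑ i, M (σ (e (i, false))) (σ (e (j, true))) - d / 2|}} : ℝ) ≤
      Fintype.card (Equiv.Perm α) * Real.exp (-(C ^ 2 / 4 - 1)) ^ k := by
  have hk' : (1 : ℝ) ≤ k := by exact_mod_cast hk
  have hle : 2 * Fintype.card ι ≤ Fintype.card α := by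
    have := Fintype.card_le_of_embedding e
    rwa [Fintype.card_prod, Fintype.card_bool, mul_comm] at this
  set D : Equiv.Perm α → ι → Prop := fun σ j =>
    k * δ < |∑ i, M (σ (e (i, false))) (σ (e (j, true))) - d / 2|
  set t : ℝ := Fintype.card α * Real.exp (-(k : ℝ) ^ 2) with ht
  rcases Nat.eq_zero_or_pos (Fintype.card α) with h0 | hpos
  · have hι : IsEmpty ι := by
      rw [← Fintype.card_eq_zero_iff]
      omega
    have : #{σ : Equiv.Perm α | t < #{j | D σ j}} = 0 := by
      simp [ht, h0]
    rw [this, Nat.cast_zero]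
    positivity
  have hα : (0 : ℝ) < Fintype.card α := by exact_mod_cast hpos
  have htpos : 0 < t := by positivity
  have hmarkov : t * #{σ : Equiv.Perm α | t < #{j | D σ j}} ≤
      ∑ σ : Equiv.Perm α, (#{j | D σ j} : ℝ) := by
    calc _ = ∑ σ ∈ {σ : Equiv.Perm α | t < #{j | D σ j}}, t := by
          rw [Finset.sum_const, nsmul_eq_mul, mul_comm]
      _ ≤ ∑ σ ∈ {σ : Equiv.Perm α | t < #{j | D σ j}}, (#{j | D σ j} : ℝ) :=
          Finset.sum_le_sum fun σ hσ => (Finset.mem_filter.1 hσ).2.le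
      _ ≤ _ := Finset.sum_le_sum_of_subset_of_nonneg (Finset.subset_univ _)
          fun _ _ _ => Nat.cast_nonneg _
  have hswap : ∑ σ : Equiv.Perm α, (#{j | D σ j} : ℝ) =
      ∑ j, (#{σ : Equiv.Perm α | D σ j} : ℝ) := by
    simp only [Finset.card_filter, Nat.cast_sum]
    exact Finset.sum_comm
  have hbound : ∑ j, (#{σ : Equiv.Perm α | D σ j} : ℝ) ≤ Fintype.card α *
      (Fintype.card (Equiv.Perm α) * Real.exp (-((k : ℝ) ^ 2 * C ^ 2 / 4))) := by
    refine (Finset.sum_le_sum fun j _ =>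
      card_perm_column_deviation_le e hcard M hM0 hd hδ hC hM hk' j).trans ?_
    rw [Finset.sum_const, Finset.card_univ, nsmul_eq_mul]
    have h2 : 2 * (Fintype.card ι : ℝ) ≤ Fintype.card α := by exact_mod_cast hle
    have h3 : 0 ≤ Fintype.card (Equiv.Perm α) * Real.exp (-((k : ℝ) ^ 2 * C ^ 2 / 4)) := by
      positivity
    nlinarith [mul_le_mul_of_nonneg_right h2 h3]
  have hexp : Real.exp (-((k : ℝ) ^ 2 * C ^ 2 / 4)) ≤
      Real.exp (-(k : ℝ) ^ 2) * Real.exp (-(C ^ 2 / 4 - 1)) ^ k := by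
    rw [← Real.exp_nat_mul, ← Real.exp_add]
    refine Real.exp_le_exp.2 ?_
    have h4 : (k : ℝ) ≤ (k : ℝ) ^ 2 := by nlinarith
    have h5 : 0 ≤ C ^ 2 / 4 - 1 := by nlinarith
    nlinarith [mul_le_mul_of_nonneg_right h4 h5]
  refine le_of_mul_le_mul_left ?_ htpos
  rw [hswap] at hmarkov
  refine (hmarkov.trans hbound).trans ?_
  calc _ ≤ (Fintype.card α : ℝ) * (Fintype.card (Equiv.Perm α) *
        (Real.exp (-(k : ℝ) ^ 2) * Real.exp (-(C ^ 2 / 4 - 1)) ^ k)) := by gcongr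
    _ = _ := by rw [ht]; ring

theorem card_exists_pos_le_of_geometric {β : Type*} [Fintype β] (P : ℕ → β → Prop)
    [∀ k, DecidablePred (P k)] [DecidablePred fun b => ∃ k, 1 ≤ k ∧ P k b] {N q : ℝ}
    (hN : 0 ≤ N) (hq0 : 0 ≤ q) (hq1 : q < 1)
    (h : ∀ k, 1 ≤ k → (#{b | P k b} : ℝ) ≤ N * q ^ k) :
    (#{b | ∃ k, 1 ≤ k ∧ P k b} : ℝ) ≤ N * (q / (1 - q)) := by
  classical
  have hex : ∀ b, ∃ k, (∃ k, 1 ≤ k ∧ P k b) → P (k + 1) b := fun b => by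
    by_cases hb : ∃ k, 1 ≤ k ∧ P k b
    · obtain ⟨k, hk, hP⟩ := hb
      exact ⟨k - 1, fun _ => by rwa [Nat.sub_add_cancel hk]⟩
    · exact ⟨0, fun h => absurd h hb⟩
  choose f hf using hex
  set K := univ.sup f
  have hsub : ({b | ∃ k, 1 ≤ k ∧ P k b} : Finset β) ⊆
      (Finset.range (K + 1)).biUnion fun k => {b | P (k + 1) b} := fun b hb => by
    simp only [Finset.mem_biUnion, Finset.mem_range, Finset.mem_filter, Finset.mem_univ,
      true_and] at hb ⊢
    exact ⟨f b, Nat.lt_succ_of_le (Finset.le_sup (Finset.mem_univ b)), hf b hb⟩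
  calc (#{b | ∃ k, 1 ≤ k ∧ P k b} : ℝ)
      ≤ ∑ k ∈ Finset.range (K + 1), (#{b | P (k + 1) b} : ℝ) := by
        exact_mod_cast (Finset.card_le_card hsub).trans Finset.card_biUnion_le
    _ ≤ ∑ k ∈ Finset.range (K + 1), N * q ^ (k + 1) :=
        Finset.sum_le_sum fun k _ => h (k + 1) (by omega)
    _ = N * (q * ∑ k ∈ Finset.range (K + 1), q ^ k) := by
        rw [Finset.mul_sum, Finset.mul_sum]
        exact Finset.sum_congr rfl fun k _ => by ring
    _ ≤ N * (q * (1 - q)⁻¹) := by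
        gcongr
        rw [← tsum_geometric_of_lt_one hq0 hq1]
        exact (summable_geometric_of_lt_one hq0 hq1).sum_le_tsum _ fun _ _ => by positivity
    _ = _ := by rw [div_eq_mul_inv]

/-- For every `k ≥ 1`, at most `n * exp (-k ^ 2)` column sums, and as many row sums, of the corner
of `B` differ from `d / 2` by more than `k * δ`. -/
def CornerSumsConcentrated {n : ℕ} (d δ : ℝ) (B : Matrix (Fin n) (Fin n) ℝ) : Prop :=
  ∀ k : ℕ, 1 ≤ k →
    (Nat.card {i : Fin (n / 2) // (k : ℝ) * δ < |(∑ j, |corner B j i|) - d / 2|} : ℝ) ≤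
      n * Real.exp (-(k : ℝ) ^ 2) ∧
    (Nat.card {i : Fin (n / 2) // (k : ℝ) * δ < |(∑ j, |corner B i j|) - d / 2|} : ℝ) ≤
      n * Real.exp (-(k : ℝ) ^ 2)

/-- The row indices (`false`) and the column indices (`true`) of the top right corner. -/
def cornerIndex (n : ℕ) : Fin (n / 2) × Bool ↪ Fin n where
  toFun x := if x.2 then ⟨n - n / 2 + x.1.1, by omega⟩ else ⟨x.1.1, by omega⟩
  inj' := by
    rintro ⟨⟨i, hi⟩, a⟩ ⟨⟨j, hj⟩, b⟩ h
    cases a <;> cases b <;> simp at h ⊢ <;> omega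

open Classical in
theorem card_perm_not_cornerSumsConcentrated_le {n : ℕ} (B : Matrix (Fin n) (Fin n) ℝ)
    {d δ C : ℝ} (hB0 : ∀ i j, 0 ≤ B i j) (hrow : ∀ i, ∑ j, B i j = d)
    (hcol : ∀ j, ∑ i, B i j = d) (hδ : 0 < δ) (hC : 2 < C)
    (hrowsq : ∀ i, C ^ 2 * ∑ j, B i j ^ 2 ≤ δ ^ 2)
    (hcolsq : ∀ j, C ^ 2 * ∑ i, B i j ^ 2 ≤ δ ^ 2) {q : ℝ}
    (hq : q = Real.exp (-(C ^ 2 / 4 - 1))) :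
    (#{σ : Equiv.Perm (Fin n) | ¬ CornerSumsConcentrated d δ (B.submatrix σ σ)} : ℝ) ≤
      Fintype.card (Equiv.Perm (Fin n)) * (2 * (q / (1 - q))) := by
  have hq0 : 0 ≤ q := hq ▸ Real.exp_nonneg _
  have hq1 : q < 1 := by
    rw [hq, Real.exp_lt_one_iff]
    nlinarith
  set Q : Matrix (Fin n) (Fin n) ℝ → (Fin (n / 2) × Bool ↪ Fin n) → ℕ →
      Equiv.Perm (Fin n) → Prop := fun M e k σ =>
    Fintype.card (Fin n) * Real.exp (-(k : ℝ) ^ 2) <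
      (#{j | k * δ < |∑ i, M (σ (e (i, false))) (σ (e (j, true))) - d / 2|} : ℝ) with hQ
  set e := cornerIndex n
  set e' : Fin (n / 2) × Bool ↪ Fin n :=
    (((Equiv.refl _).prodCongr Equiv.boolNot).toEmbedding).trans e
  have hcard : Fintype.card (Fin n) ≤ 2 * Fintype.card (Fin (n / 2)) + 1 := by
    simp only [Fintype.card_fin]
    omega
  have h1 := card_exists_pos_le_of_geometric (Q B e) (Nat.cast_nonneg _) hq0 hq1
    fun k hk => hq ▸ card_perm_many_deviations_le e hcard B hB0 hcol hδ hC.le hcolsq hk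
  have h2 := card_exists_pos_le_of_geometric (Q Bᵀ e') (Nat.cast_nonneg _) hq0 hq1
    fun k hk => hq ▸ card_perm_many_deviations_le e' hcard Bᵀ (fun a c => hB0 c a) hrow hδ hC.le
      hrowsq hk
  have hsub : ({σ : Equiv.Perm (Fin n) | ¬ CornerSumsConcentrated d δ (B.submatrix σ σ)} :
      Finset (Equiv.Perm (Fin n))) ⊆ univ.filter (fun σ => ∃ k, 1 ≤ k ∧ Q B e k σ) ∪
        univ.filter fun σ => ∃ k, 1 ≤ k ∧ Q Bᵀ e' k σ := fun σ hσ => by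
    simp only [Finset.mem_union, Finset.mem_filter, Finset.mem_univ, true_and] at hσ ⊢
    contrapose! hσ
    intro k hk
    have h3 := hσ.1 k hk
    have h4 := hσ.2 k hk
    simp only [hQ, not_lt, Fintype.card_fin] at h3 h4
    simp only [Nat.card_eq_fintype_card, Fintype.card_subtype, corner, Matrix.submatrix_apply,
      abs_of_nonneg (hB0 _ _)]
    exact ⟨h3, h4⟩
  have h5 : (#{σ : Equiv.Perm (Fin n) | ¬ CornerSumsConcentrated d δ (B.submatrix σ σ)} : ℝ) ≤
      #{σ | ∃ k, 1 ≤ k ∧ Q B e k σ} + #{σ | ∃ k, 1 ≤ k ∧ Q Bᵀ e' k σ} := by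
    exact_mod_cast (Finset.card_le_card hsub).trans (Finset.card_union_le _ _)
  linarith

theorem measurableSet_cornerSumsConcentrated {n : ℕ} (d δ : ℝ) (π : Equiv.Perm (Fin n)) :
    MeasurableSet {B : Matrix (Fin n) (Fin n) ℝ |
      CornerSumsConcentrated d δ (B.submatrix π π)} := by
  classical
  have hent : ∀ i j, Measurable fun B : Matrix (Fin n) (Fin n) ℝ => B i j := fun i j =>
    (measurable_pi_apply j).comp (measurable_pi_apply i)
  have hcard : ∀ (k : ℕ) (F : Matrix (Fin n) (Fin n) ℝ → Fin (n / 2) → Fin (n / 2) → ℝ),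
      (∀ i j, Measurable fun B => F B i j) →
      Measurable fun B => (Nat.card {i : Fin (n / 2) //
        (k : ℝ) * δ < |(∑ j, |F B i j|) - d / 2|} : ℝ) := fun k F hF => by
    simp only [Nat.card_eq_fintype_card, Fintype.card_subtype, Finset.card_filter, Nat.cast_sum]
    refine Finset.measurable_sum _ fun i _ => ?_
    have hS : MeasurableSet {B | (k : ℝ) * δ < |(∑ j, |F B i j|) - d / 2|} :=
      measurableSet_lt measurable_const
        ((Finset.measurable_sum _ fun j _ => (hF i j).abs).sub_const _).abs
    push_cast
    exact Measurable.ite hS measurable_const measurable_const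
  simp only [CornerSumsConcentrated, Set.ofPred_forall, Set.ofPred_and]
  refine MeasurableSet.iInter fun k => MeasurableSet.iInter fun _ => ?_
  exact (measurableSet_le (hcard k (fun B i j => corner (B.submatrix π π) j i)
      fun i j => hent _ _) measurable_const).inter
    (measurableSet_le (hcard k (fun B i j => corner (B.submatrix π π) i j)
      fun i j => hent _ _) measurable_const)

/-- If `σ` is uniform on a finite type and independent of `A`, then conditioning on `A` amounts to
averaging over the values of `σ`. -/
theorem condExp_indicator_ae_eq_average {Ω X S : Type*} {mΩ : MeasurableSpace Ω} {μ : Measure Ω}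
    [IsProbabilityMeasure μ] [mX : MeasurableSpace X] [Fintype S] [MeasurableSpace S]
    [MeasurableSingletonClass S] {A : Ω → X} {σ : Ω → S} (hA : Measurable A) (hσ : Measurable σ)
    (hunif : ∀ s, μ {ω | σ ω = s} = ((Fintype.card S : ℝ≥0∞))⁻¹) (hind : IndepFun A σ μ)
    (G : X → S → Prop) [∀ x s, Decidable (G x s)] (hG : ∀ s, MeasurableSet {x | G x s}) :
    μ[{ω | G (A ω) (σ ω)}.indicator (fun _ => (1 : ℝ)) | mX.comap A] =ᵐ[μ]
      fun ω => (#{s | G (A ω) s} : ℝ) / Fintype.card S := by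
  classical
  have hmeas : ∀ s, MeasurableSet {ω | σ ω = s} := fun s => hσ (measurableSet_singleton s)
  have hint : ∀ s, Integrable ({ω | σ ω = s}.indicator fun _ => (1 : ℝ)) μ := fun s =>
    (integrable_const _).indicator (hmeas s)
  have hGA : ∀ s, MeasurableSet[mX.comap A] {ω | G (A ω) s} := fun s => ⟨_, hG s, rfl⟩
  have hdecomp : {ω | G (A ω) (σ ω)}.indicator (fun _ => (1 : ℝ)) =
      ∑ s, {ω | G (A ω) s}.indicator ({ω | σ ω = s}.indicator fun _ => (1 : ℝ)) := by
    funext ω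
    simp only [Finset.sum_apply, Set.indicator_apply, Set.mem_ofPred_eq]
    rw [Finset.sum_eq_single (σ ω)]
    · simp
    · intro s _ hs
      simp [hs.symm]
    · simp
  have hterm : ∀ s, μ[{ω | G (A ω) s}.indicator ({ω | σ ω = s}.indicator fun _ => (1 : ℝ)) |
      mX.comap A] =ᵐ[μ] {ω | G (A ω) s}.indicator fun _ => ((Fintype.card S : ℝ))⁻¹ := fun s => by
    have hind' : μ[{ω | σ ω = s}.indicator (fun _ => (1 : ℝ)) | mX.comap A] =ᵐ[μ]
        fun _ => ((Fintype.card S : ℝ))⁻¹ := by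
      refine (condExp_indep_eq hσ.comap_le hA.comap_le ?_ hind.symm).trans ?_
      · exact stronglyMeasurable_const.indicator ⟨{s}, measurableSet_singleton s, rfl⟩
      · rw [integral_indicator_const _ (hmeas s), measureReal_def, hunif s]
        simp
    filter_upwards [condExp_indicator (hint s) (hGA s), hind'] with ω h1 h2
    rw [h1]
    simp only [Set.indicator_apply, h2]
  rw [hdecomp]
  have hsum := condExp_finsetSum (s := (univ : Finset S)) (μ := μ)
    (f := fun s => {ω | G (A ω) s}.indicator ({ω | σ ω = s}.indicator fun _ => (1 : ℝ)))
    (fun s _ => (hint s).indicator (hA.comap_le _ (hGA s))) (mX.comap A)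
  filter_upwards [hsum, ae_all_iff.2 hterm] with ω h1 h2
  rw [h1, Finset.sum_apply, Finset.sum_congr rfl fun s _ => h2 s]
  simp only [Set.indicator_apply, Set.mem_ofPred_eq]
  rw [← Finset.sum_filter, Finset.sum_const, nsmul_eq_mul, div_eq_mul_inv]

/-- **Lemma 5.** For every `γ ∈ (0,1)` there is a constant `C > 0` with the following
property. Let `A` be an `n × n` random matrix taking values in `𝒜_n(d)`, let `δ > 0` be
such that a.s. `C‖row_i(A)‖₂ ≤ δ` and `C‖col_i(A)‖₂ ≤ δ` for all `i`, let `σ` be a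
uniform random permutation independent of `A`, and let `T_s` be the `⌊n/2⌋ × ⌊n/2⌋` top
right corner of `σ(A)`. Let `E` be the event that for all `k ≥ 1` at most `n·e^{−k²}`
of the column sums `u_i(T_s)` (resp. row sums `v_i(T_s)`) differ from `d/2` by more than
`kδ`. Then `P(E | A) ≥ 1 − γ` almost surely. -/
theorem stmt_6 (γ : ℝ) (hγ0 : 0 < γ) (hγ1 : γ < 1) :
    ∃ C : ℝ, 0 < C ∧
      ∀ (n : ℕ) (d δ : ℝ), 0 < δ →
      ∀ (Ω : Type) (_ : MeasurableSpace Ω) (μ : Measure Ω), IsProbabilityMeasure μ →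
      ∀ (A : Ω → Matrix (Fin n) (Fin n) ℝ) (σ : Ω → Equiv.Perm (Fin n)),
        Measurable A →
        Measurable σ →
        -- A takes values in 𝒜_n(d)
        (∀ ω, (∀ i j, 0 ≤ A ω i j) ∧ (∀ i, ∑ j, A ω i j = d) ∧ (∀ j, ∑ i, A ω i j = d)) →
        -- a.s. bounds on the Euclidean norms of the rows and columns
        (∀ᵐ ω ∂μ, ∀ i,
          C * Real.sqrt (∑ j, (A ω i j) ^ 2) ≤ δ ∧
            C * Real.sqrt (∑ j, (A ω j i) ^ 2) ≤ δ) →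
        -- σ is uniformly distributed on the permutation group
        (∀ π : Equiv.Perm (Fin n),
          μ {ω | σ ω = π} = ((Fintype.card (Equiv.Perm (Fin n)) : ℝ≥0∞))⁻¹) →
        -- σ is independent of A
        IndepFun A σ μ →
        -- the event E
        ∀ E : Set Ω,
          E = {ω | ∀ k : ℕ, 1 ≤ k →
            (Nat.card {i : Fin (n / 2) //
                (k : ℝ) * δ <
                  |(∑ j, |corner ((A ω).submatrix (σ ω) (σ ω)) j i|) - d / 2|} : ℝ) ≤
              n * Real.exp (-(k : ℝ) ^ 2) ∧
            (Nat.card {i : Fin (n / 2) //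
                (k : ℝ) * δ <
                  |(∑ j, |corner ((A ω).submatrix (σ ω) (σ ω)) i j|) - d / 2|} : ℝ) ≤
              n * Real.exp (-(k : ℝ) ^ 2)} →
          ∀ᵐ ω ∂μ, 1 - γ ≤
            (μ[E.indicator (fun _ => (1 : ℝ)) |
              MeasurableSpace.comap A inferInstance]) ω := by
  classical
  set L := Real.log (4 / γ) with hL
  have hL0 : 0 < L := Real.log_pos (by rw [lt_div_iff₀ hγ0]; linarith)
  set C := 2 * Real.sqrt (1 + L) with hCdef
  have hC2 : C ^ 2 = 4 * (1 + L) := by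
    rw [hCdef, mul_pow, Real.sq_sqrt (by linarith)]
    norm_num
  have hC : 2 < C := by
    have : 0 ≤ C := by positivity
    nlinarith
  have hq : γ / 4 = Real.exp (-(C ^ 2 / 4 - 1)) := by
    rw [hC2, show -(4 * (1 + L) / 4 - 1) = -L by ring, Real.exp_neg, hL,
      Real.exp_log (by positivity), inv_div]
  refine ⟨C, by linarith, ?_⟩
  intro n d δ hδ Ω _ μ _ A σ hA hσ hAn hnorm hunif hind E hE
  have hcond := condExp_indicator_ae_eq_average hA hσ hunif hind
    (fun B π => CornerSumsConcentrated d δ (B.submatrix π π))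
    (measurableSet_cornerSumsConcentrated d δ)
  have hEeq : E = {ω | CornerSumsConcentrated d δ ((A ω).submatrix (σ ω) (σ ω))} := hE
  rw [hEeq]
  filter_upwards [hcond, hnorm] with ω hω hnω
  have hsq : ∀ s : ℝ, 0 ≤ s → C * Real.sqrt s ≤ δ → C ^ 2 * s ≤ δ ^ 2 := fun s hs h => by
    rw [← Real.sq_sqrt hs, ← mul_pow]
    exact pow_le_pow_left₀ (by positivity) h 2
  have hbad := card_perm_not_cornerSumsConcentrated_le (A ω) (hAn ω).1 (hAn ω).2.1 (hAn ω).2.2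
    hδ hC (fun i => hsq _ (Finset.sum_nonneg fun _ _ => sq_nonneg _) (hnω i).1)
    (fun i => hsq _ (Finset.sum_nonneg fun _ _ => sq_nonneg _) (hnω i).2) hq
  have hN : (0 : ℝ) < Fintype.card (Equiv.Perm (Fin n)) := by exact_mod_cast Fintype.card_pos
  have hsplit : (#{π : Equiv.Perm (Fin n) |
        CornerSumsConcentrated d δ ((A ω).submatrix π π)} : ℝ) +
      #{π : Equiv.Perm (Fin n) | ¬ CornerSumsConcentrated d δ ((A ω).submatrix π π)} =
      Fintype.card (Equiv.Perm (Fin n)) := by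
    exact_mod_cast Finset.card_filter_add_card_filter_not
      (s := univ) fun π : Equiv.Perm (Fin n) =>
        CornerSumsConcentrated d δ ((A ω).submatrix π π)
  have hgeom : 2 * (γ / 4 / (1 - γ / 4)) ≤ γ := by
    rw [← mul_div_assoc, div_le_iff₀ (by linarith)]
    nlinarith
  rw [hω, le_div_iff₀ hN]
  nlinarith [mul_le_mul_of_nonneg_left hgeom hN.le]
end

section
/- Let m ≥ 2, let 1 ≤ k ≤ m, let (a_i)_{i=1}^m be real numbers, let 𝒮 be a uniformly distributed random subset of {1,…,m} of cardinality k, and for each i let χ_i be the indicator of {i ∈ 𝒮}. Then E(Σ_{i=1}^m a_i χ_i)⁴ ≤ (k⁴/m⁴)·(Σ a_i)⁴ + (6k³/m³)·(Σ a_i²)·(Σ a_i)² + (7k/m)·(Σ a_i²)² + (12k²/m²)·(Σ a_i²)^{3/2}·|Σ a_i|, where all sums run over i = 1,…,m. -/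
open MeasureTheory ProbabilityTheory Finset
open scoped ENNReal

instance finsetMeasurableSpace {n : ℕ} : MeasurableSpace (Finset (Fin n)) := ⊤

/-- The probability that a uniform random `k`-subset of an `m`-element set contains a given
`t`-element set. -/
noncomputable def inclusionProb (m k t : ℕ) : ℝ :=
  (k.descFactorial t : ℝ) / (m.descFactorial t : ℝ)

lemma inclusionProb_nonneg (m k t : ℕ) : 0 ≤ inclusionProb m k t := by
  unfold inclusionProb; positivity

lemma inclusionProb_zero (m k : ℕ) : inclusionProb m k 0 = 1 := by
  simp [inclusionProb]

lemma inclusionProb_succ_le {m k : ℕ} (hkm : k ≤ m) (t : ℕ) :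
    inclusionProb m k (t + 1) ≤ (k : ℝ) / m * inclusionProb m k t := by
  have hratio : ((k - t : ℕ) : ℝ) / ((m - t : ℕ) : ℝ) ≤ (k : ℝ) / m := by
    rcases le_or_gt k t with h | h
    · simp only [Nat.sub_eq_zero_of_le h, Nat.cast_zero, zero_div]
      positivity
    · have hk' : (t : ℝ) < k := by exact_mod_cast h
      have hkm' : (k : ℝ) ≤ m := by exact_mod_cast hkm
      have ht : (0 : ℝ) ≤ t := t.cast_nonneg
      rw [Nat.cast_sub h.le, Nat.cast_sub (h.le.trans hkm),
        div_le_div_iff₀ (by linarith) (by linarith)]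
      nlinarith
  have hsucc : inclusionProb m k (t + 1) =
      ((k - t : ℕ) : ℝ) / ((m - t : ℕ) : ℝ) * inclusionProb m k t := by
    simp only [inclusionProb, Nat.descFactorial_succ, Nat.cast_mul]
    rw [div_mul_div_comm]
  rw [hsucc]
  exact mul_le_mul_of_nonneg_right hratio (inclusionProb_nonneg m k t)

lemma inclusionProb_le_pow {m k : ℕ} (hkm : k ≤ m) (t : ℕ) :
    inclusionProb m k t ≤ ((k : ℝ) / m) ^ t := by
  induction t with
  | zero => simp [inclusionProb_zero]
  | succ t ih =>
    rw [pow_succ']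
    exact (inclusionProb_succ_le hkm t).trans (mul_le_mul_of_nonneg_left ih (by positivity))

lemma inclusionProb_succ_le_self {m k : ℕ} (hkm : k ≤ m) (t : ℕ) :
    inclusionProb m k (t + 1) ≤ inclusionProb m k t :=
  (inclusionProb_succ_le hkm t).trans (mul_le_of_le_one_left (inclusionProb_nonneg m k t)
    (div_le_one_of_le₀ (by exact_mod_cast hkm) (by positivity)))

lemma card_powersetCard_filter_subset_div {m k : ℕ} (hkm : k ≤ m) (T : Finset (Fin m)) :
    (#((powersetCard k (univ : Finset (Fin m))).filter (T ⊆ ·)) : ℝ) / (m.choose k : ℝ) =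
      inclusionProb m k #T := by
  rcases le_or_gt #T k with hT | hT
  · have h := Nat.choose_mul (n := m) hT
    have hchoose : (m.choose k : ℝ) ≠ 0 := by exact_mod_cast (Nat.choose_pos hkm).ne'
    have hdesc : (m.descFactorial #T : ℝ) ≠ 0 := by
      exact_mod_cast (Nat.descFactorial_pos.2 (hT.trans hkm)).ne'
    rw [card_filter_powersetCard_subset T univ k (subset_univ T) hT, card_univ,
      Fintype.card_fin, inclusionProb, div_eq_div_iff hchoose hdesc]
    norm_cast
    rw [Nat.descFactorial_eq_factorial_mul_choose, Nat.descFactorial_eq_factorial_mul_choose]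
    calc _ = (#T).factorial * (m.choose #T * (m - #T).choose (k - #T)) := by ring
      _ = _ := by rw [← h]; ring
  · rw [filter_eq_empty_iff.2, inclusionProb, Nat.descFactorial_of_lt hT]
    · simp
    · intro s hs hTs
      have := card_le_card hTs
      rw [(mem_powersetCard.1 hs).2] at this
      omega

lemma measureReal_subset_eq_inclusionProb {m k : ℕ} (hkm : k ≤ m) {Ω : Type*} [MeasurableSpace Ω]
    (μ : Measure Ω) [IsProbabilityMeasure μ] {S : Ω → Finset (Fin m)} (hSmeas : Measurable S)
    (hScard : ∀ ω, #(S ω) = k)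
    (hSunif : ∀ s : Finset (Fin m), #s = k → μ {ω | S ω = s} = ((m.choose k : ℝ≥0∞))⁻¹)
    (T : Finset (Fin m)) :
    μ.real {ω | T ⊆ S ω} = inclusionProb m k #T := by
  have hset : {ω | T ⊆ S ω} =
      ⋃ s ∈ (powersetCard k (univ : Finset (Fin m))).filter (T ⊆ ·), {ω | S ω = s} := by
    ext ω
    simp [hScard]
  rw [hset, measureReal_biUnion_finset, sum_congr rfl (g := fun _ => ((m.choose k : ℝ))⁻¹),
    sum_const, nsmul_eq_mul, ← div_eq_mul_inv, card_powersetCard_filter_subset_div hkm]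
  · intro s hs
    rw [measureReal_def, hSunif s (mem_powersetCard.1 (mem_filter.1 hs).1).2]
    simp
  · intro s _ t _ hst
    exact Set.disjoint_left.2 fun ω h₁ h₂ => hst (h₁.symm.trans h₂)
  · intro s _
    exact hSmeas (t := {s}) trivial

lemma sum_pow_four {ι : Type*} (s : Finset ι) (f : ι → ℝ) :
    (∑ i ∈ s, f i) ^ 4 = ∑ i ∈ s, ∑ j ∈ s, ∑ k ∈ s, ∑ l ∈ s, f i * f j * f k * f l := by
  simp only [← mul_sum, ← sum_mul]
  ring

lemma integral_sum_indicator_pow_four {m : ℕ} {Ω : Type*} [MeasurableSpace Ω]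
    (μ : Measure Ω) [IsProbabilityMeasure μ] {S : Ω → Finset (Fin m)} (hSmeas : Measurable S)
    (a : Fin m → ℝ) :
    ∫ ω, (∑ i, a i * (if i ∈ S ω then (1 : ℝ) else 0)) ^ 4 ∂μ =
      ∑ i, ∑ j, ∑ k, ∑ l, a i * a j * a k * a l *
        μ.real {ω | ({i, j, k, l} : Finset (Fin m)) ⊆ S ω} := by
  have hmeas (T : Finset (Fin m)) : MeasurableSet {ω | T ⊆ S ω} :=
    hSmeas (t := {s | T ⊆ s}) trivial
  have hpt (ω : Ω) : (∑ i, a i * (if i ∈ S ω then (1 : ℝ) else 0)) ^ 4 =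
      ∑ i, ∑ j, ∑ k, ∑ l, a i * a j * a k * a l *
        ({ω | ({i, j, k, l} : Finset (Fin m)) ⊆ S ω}.indicator 1 ω) := by
    rw [sum_pow_four]
    refine sum_congr rfl fun i _ => sum_congr rfl fun j _ => sum_congr rfl fun k _ =>
      sum_congr rfl fun l _ => ?_
    by_cases hi : i ∈ S ω <;> by_cases hj : j ∈ S ω <;> by_cases hk : k ∈ S ω <;>
      by_cases hl : l ∈ S ω <;> simp [Set.indicator, insert_subset_iff, hi, hj, hk, hl]
  have hintegrable (c : ℝ) (T : Finset (Fin m)) :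
      Integrable (fun ω => c * ({ω | T ⊆ S ω}.indicator (1 : Ω → ℝ) ω)) μ :=
    ((integrable_const (1 : ℝ)).indicator (hmeas T)).const_mul c
  simp only [hpt]
  rw [integral_finsetSum _ fun i _ => integrable_finsetSum _ fun j _ =>
    integrable_finsetSum _ fun k _ => integrable_finsetSum _ fun l _ => hintegrable _ _]
  refine sum_congr rfl fun i _ => ?_
  rw [integral_finsetSum _ fun j _ =>
    integrable_finsetSum _ fun k _ => integrable_finsetSum _ fun l _ => hintegrable _ _]
  refine sum_congr rfl fun j _ => ?_
  rw [integral_finsetSum _ fun k _ => integrable_finsetSum _ fun l _ => hintegrable _ _]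
  refine sum_congr rfl fun k _ => ?_
  rw [integral_finsetSum _ fun l _ => hintegrable _ _]
  refine sum_congr rfl fun l _ => ?_
  rw [integral_const_mul, integral_indicator_one (hmeas _)]

/-- Möbius inversion over the set partitions of four indices. -/
lemma apply_card_quadruple {ι : Type*} [DecidableEq ι] (P : ℕ → ℝ) (i j k l : ι) :
    P #({i, j, k, l} : Finset ι) = P 4
      + (P 3 - P 4) * ((if i = j then 1 else 0) + (if i = k then 1 else 0)
        + (if i = l then 1 else 0) + (if j = k then 1 else 0)
        + (if j = l then 1 else 0) + (if k = l then 1 else 0))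
      + (P 2 - 2 * P 3 + P 4) * ((if i = j then if k = l then 1 else 0 else 0)
        + (if i = k then if j = l then 1 else 0 else 0)
        + (if i = l then if j = k then 1 else 0 else 0))
      + (P 2 - 3 * P 3 + 2 * P 4) * ((if i = j then if j = k then 1 else 0 else 0)
        + (if i = j then if j = l then 1 else 0 else 0)
        + (if i = k then if k = l then 1 else 0 else 0)
        + (if j = k then if k = l then 1 else 0 else 0))
      + (P 1 - 7 * P 2 + 12 * P 3 - 6 * P 4) *
        (if i = j then if j = k then if k = l then 1 else 0 else 0 else 0) := by
  by_cases hij : i = j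
  · subst hij
    by_cases hik : i = k
    · subst hik
      by_cases hil : i = l
      · subst hil; simp; ring
      · simp [hil]; ring
    · by_cases hil : i = l
      · subst hil; simp [hik, Ne.symm hik]; ring
      · by_cases hkl : k = l
        · subst hkl; simp [hik]; ring
        · simp [hik, hil, hkl]
  · by_cases hik : i = k
    · subst hik
      by_cases hil : i = l
      · subst hil; simp [hij, Ne.symm hij]; ring
      · by_cases hjl : j = l
        · subst hjl; simp [hij, Ne.symm hij]; ring
        · simp [hij, Ne.symm hij, hil, hjl]
    · by_cases hil : i = l
      · subst hil
        by_cases hjk : j = k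
        · subst hjk; simp [hij, Ne.symm hij]; ring
        · simp [hij, hik, hjk, Ne.symm hij, Ne.symm hik]
      · by_cases hjk : j = k
        · subst hjk
          by_cases hjl : j = l
          · subst hjl; simp [hij]; ring
          · simp [hij, hil, hjl]
        · by_cases hjl : j = l
          · subst hjl; simp [hij, hik, hjk, Ne.symm hjk]
          · by_cases hkl : k = l
            · subst hkl; simp [hij, hik, hjk]
            · simp [hij, hik, hil, hjk, hjl, hkl]

lemma sum_quadruple_mul_apply_card {ι : Type*} [Fintype ι] [DecidableEq ι] (P : ℕ → ℝ)
    (a : ι → ℝ) :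
    ∑ i, ∑ j, ∑ k, ∑ l, a i * a j * a k * a l * P #({i, j, k, l} : Finset ι) =
      P 4 * (∑ i, a i) ^ 4 + 6 * (P 3 - P 4) * (∑ i, a i ^ 2) * (∑ i, a i) ^ 2
        + 3 * (P 2 - 2 * P 3 + P 4) * (∑ i, a i ^ 2) ^ 2
        + 4 * (P 2 - 3 * P 3 + 2 * P 4) * (∑ i, a i ^ 3) * (∑ i, a i)
        + (P 1 - 7 * P 2 + 12 * P 3 - 6 * P 4) * ∑ i, a i ^ 4 := by
  simp only [apply_card_quadruple, mul_add, mul_ite, mul_one, mul_zero, sum_add_distrib,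
    sum_ite_eq, mem_univ, if_true, sum_ite_irrel, sum_const_zero]
  simp only [← mul_sum, ← sum_mul]
  ring_nf
  simp only [← mul_sum, ← sum_mul]
  ring_nf
  simp only [← mul_sum]
  ring

lemma sum_pow_four_le_sq {ι : Type*} (s : Finset ι) (a : ι → ℝ) :
    ∑ i ∈ s, a i ^ 4 ≤ (∑ i ∈ s, a i ^ 2) ^ 2 := by
  rw [sq, sum_mul]
  refine sum_le_sum fun i hi => ?_
  have h := single_le_sum (f := fun i => a i ^ 2) (fun i _ => sq_nonneg (a i)) hi
  nlinarith [sq_nonneg (a i)]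

lemma abs_sum_pow_three_le_rpow {ι : Type*} (s : Finset ι) (a : ι → ℝ) :
    |∑ i ∈ s, a i ^ 3| ≤ (∑ i ∈ s, a i ^ 2) ^ ((3 : ℝ) / 2) := by
  have hq : 0 ≤ ∑ i ∈ s, a i ^ 2 := sum_nonneg fun i _ => sq_nonneg (a i)
  have hrpow : (∑ i ∈ s, a i ^ 2) ^ ((3 : ℝ) / 2) =
      (∑ i ∈ s, a i ^ 2) * √(∑ i ∈ s, a i ^ 2) := by
    rw [Real.sqrt_eq_rpow, show (3 : ℝ) / 2 = 1 + 1 / 2 by norm_num,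
      Real.rpow_add_of_nonneg hq (by norm_num) (by norm_num), Real.rpow_one]
  rw [hrpow, sum_mul]
  refine (abs_sum_le_sum_abs _ _).trans (sum_le_sum fun i hi => ?_)
  rw [pow_succ, abs_mul, abs_of_nonneg (sq_nonneg (a i))]
  exact mul_le_mul_of_nonneg_left (Real.abs_le_sqrt
    (single_le_sum (f := fun i => a i ^ 2) (fun i _ => sq_nonneg (a i)) hi)) (sq_nonneg (a i))

/-- Fourth moment bound for a sum over a uniform random `k`-subset of `{1,…,m}`:
`E(Σ_i a_i χ_i)⁴ ≤ (k⁴/m⁴)(Σ a_i)⁴ + (6k³/m³)(Σ a_i²)(Σ a_i)² + (7k/m)(Σ a_i²)²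
  + (12k²/m²)(Σ a_i²)^{3/2} |Σ a_i|`. -/
theorem stmt_13 (m k : ℕ) (hm : 2 ≤ m) (hk1 : 1 ≤ k) (hk2 : k ≤ m)
    (a : Fin m → ℝ)
    (Ω : Type) [MeasurableSpace Ω] (μ : Measure Ω) [IsProbabilityMeasure μ]
    (S : Ω → Finset (Fin m))
    (hSmeas : Measurable S)
    (hScard : ∀ ω, (S ω).card = k)
    (hSunif : ∀ s : Finset (Fin m), s.card = k →
      μ {ω | S ω = s} = ((Nat.choose m k : ℝ≥0∞))⁻¹) :
    ∫ ω, (∑ i, a i * (if i ∈ S ω then (1 : ℝ) else 0)) ^ 4 ∂μ ≤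
      (k : ℝ) ^ 4 / (m : ℝ) ^ 4 * (∑ i, a i) ^ 4 +
        6 * (k : ℝ) ^ 3 / (m : ℝ) ^ 3 * (∑ i, (a i) ^ 2) * (∑ i, a i) ^ 2 +
        7 * (k : ℝ) / m * (∑ i, (a i) ^ 2) ^ 2 +
        12 * (k : ℝ) ^ 2 / (m : ℝ) ^ 2 * (∑ i, (a i) ^ 2) ^ ((3 : ℝ) / 2) *
          |∑ i, a i| := by
  rw [integral_sum_indicator_pow_four μ hSmeas a]
  simp only [measureReal_subset_eq_inclusionProb hk2 μ hSmeas hScard hSunif]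
  rw [sum_quadruple_mul_apply_card (inclusionProb m k) a]
  have h10 := inclusionProb_le_pow hk2 1
  have h2p := inclusionProb_le_pow hk2 2
  have h3p := inclusionProb_le_pow hk2 3
  have h4p := inclusionProb_le_pow hk2 4
  have h21 := inclusionProb_succ_le_self hk2 1
  have h32 := inclusionProb_succ_le_self hk2 2
  have h43 := inclusionProb_succ_le_self hk2 3
  have h4 := inclusionProb_nonneg m k 4
  have hcube := abs_sum_pow_three_le_rpow univ a
  have hfour := sum_pow_four_le_sq univ a
  have hfour_nonneg : 0 ≤ ∑ i, a i ^ 4 := sum_nonneg fun i _ => by positivity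
  have hsq_nonneg : 0 ≤ ∑ i, a i ^ 2 := sum_nonneg fun i _ => sq_nonneg (a i)
  simp only [Nat.reduceAdd, pow_one] at *
  rw [← div_pow, mul_div_assoc, ← div_pow, mul_div_assoc, mul_div_assoc, ← div_pow]
  set p : ℝ := (k : ℝ) / m
  set p₁ := inclusionProb m k 1
  set p₂ := inclusionProb m k 2
  set p₃ := inclusionProb m k 3
  set p₄ := inclusionProb m k 4
  set s := ∑ i, a i
  set q := ∑ i, a i ^ 2
  set c := ∑ i, a i ^ 3
  set d := ∑ i, a i ^ 4
  set r := q ^ ((3 : ℝ) / 2)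
  have hA : p₄ * s ^ 4 ≤ p ^ 4 * s ^ 4 := by gcongr
  have hB : 6 * (p₃ - p₄) * q * s ^ 2 ≤ 6 * p ^ 3 * q * s ^ 2 := by
    gcongr; linarith
  have hC : 3 * (p₂ - 2 * p₃ + p₄) * q ^ 2 + (p₁ - 7 * p₂ + 12 * p₃ - 6 * p₄) * d ≤
      7 * p * q ^ 2 := by
    rcases le_total 0 (p₁ - 7 * p₂ + 12 * p₃ - 6 * p₄) with h | h
    · calc _ ≤ 3 * (p₂ - 2 * p₃ + p₄) * q ^ 2 + (p₁ - 7 * p₂ + 12 * p₃ - 6 * p₄) * q ^ 2 := by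
            gcongr
        _ = (p₁ - 4 * p₂ + 6 * p₃ - 3 * p₄) * q ^ 2 := by ring
        _ ≤ 7 * p * q ^ 2 := mul_le_mul_of_nonneg_right (by linarith) (sq_nonneg q)
    · calc _ ≤ 3 * (p₂ - 2 * p₃ + p₄) * q ^ 2 :=
            add_le_of_nonpos_right (mul_nonpos_of_nonpos_of_nonneg h hfour_nonneg)
        _ ≤ 7 * p * q ^ 2 := mul_le_mul_of_nonneg_right (by linarith) (sq_nonneg q)
  have hD : 4 * (p₂ - 3 * p₃ + 2 * p₄) * c * s ≤ 12 * p ^ 2 * r * |s| := by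
    have hcoef : |4 * (p₂ - 3 * p₃ + 2 * p₄)| ≤ 12 * p ^ 2 := by
      rw [abs_le]; constructor <;> linarith
    calc 4 * (p₂ - 3 * p₃ + 2 * p₄) * c * s ≤ |4 * (p₂ - 3 * p₃ + 2 * p₄) * c * s| :=
          le_abs_self _
      _ = |4 * (p₂ - 3 * p₃ + 2 * p₄)| * |c| * |s| := by rw [abs_mul, abs_mul]
      _ ≤ 12 * p ^ 2 * r * |s| := by gcongr
  linarith
end

section
/- Let m ∈ ℕ, let d, δ > 0, and let u, v ∈ ℝ^m have strictly positive coordinates with ‖u‖₁ = ‖v‖₁, and suppose ‖u − d𝟏‖_∞ ≤ d/3, ‖v − d𝟏‖_∞ ≤ d/3, ‖u − d𝟏‖₂ ≤ δ√m and ‖v − d𝟏‖₂ ≤ δ√m. Let D_u and D_v be the diagonal matrices with diagonal entries u_i and v_i. Then ‖ (1/‖u‖₁)·D_v 𝟏𝟏ᵗ D_u − (d/m)·𝟏𝟏ᵗ ‖ ≤ 6δ. -/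
open Matrix Finset

/-- The spectral norm is at most the Frobenius norm. -/
theorem specNorm_le_of_sum_sq_le {m n : ℕ} (A : Matrix (Fin m) (Fin n) ℝ) {c : ℝ} (hc : 0 ≤ c)
    (h : ∑ i, ∑ j, A i j ^ 2 ≤ c ^ 2) : specNorm A ≤ c := by
  refine ContinuousLinearMap.opNorm_le_bound _ hc fun x => ?_
  refine le_of_sq_le_sq ?_ (by positivity)
  rw [mul_pow, EuclideanSpace.real_norm_sq_eq, EuclideanSpace.real_norm_sq_eq]
  calc ∑ i, (LinearMap.toContinuousLinearMap (Matrix.toEuclideanLin A) x) i ^ 2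
      = ∑ i, (∑ j, A i j * x j) ^ 2 := rfl
    _ ≤ ∑ i, (∑ j, A i j ^ 2) * ∑ j, x j ^ 2 :=
        sum_le_sum fun i _ => sum_mul_sq_le_sq_mul_sq _ _ _
    _ = (∑ i, ∑ j, A i j ^ 2) * ∑ j, x j ^ 2 := by rw [sum_mul]
    _ ≤ c ^ 2 * ∑ j, x j ^ 2 := by gcongr

/-- The mean minimizes the sum of squared deviations. -/
theorem sum_sub_mean_sq_le {m : ℕ} (hm : (0 : ℝ) < m) (v : Fin m → ℝ) (d : ℝ) :
    ∑ i, (v i - (∑ k, v k) / m) ^ 2 ≤ ∑ i, (v i - d) ^ 2 := by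
  have expand (a : ℝ) :
      ∑ i, (v i - a) ^ 2 = ∑ i, v i ^ 2 - 2 * a * ∑ i, v i + m * a ^ 2 := by
    simp only [sub_sq, sum_add_distrib, sum_sub_distrib, sum_const, card_univ, Fintype.card_fin,
      nsmul_eq_mul, mul_sum]
    congr 2
    exact sum_congr rfl fun i _ => by ring
  set S := ∑ k, v k
  have hS : S = m * (S / m) := by field_simp
  rw [expand, expand]
  generalize S / m = μ at hS
  rw [hS]
  nlinarith [mul_nonneg hm.le (sq_nonneg (μ - d))]

/-- Let `u, v ∈ ℝ^m` have strictly positive coordinates with `‖u‖₁ = ‖v‖₁`, and let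
`d, δ > 0` satisfy `‖u − d𝟏‖_∞, ‖v − d𝟏‖_∞ ≤ d/3` and `‖u − d𝟏‖₂, ‖v − d𝟏‖₂ ≤ δ√m`.
Then `‖ (1/‖u‖₁)·D_v 𝟏𝟏ᵗ D_u − (d/m)·𝟏𝟏ᵗ ‖ ≤ 6δ`, where `D_v 𝟏𝟏ᵗ D_u` is the rank-one
matrix with entries `v_i u_j`. -/
theorem stmt_17 (m : ℕ) (d δ : ℝ) (hd : 0 < d) (hδ : 0 < δ)
    (u v : Fin m → ℝ)
    (hu : ∀ i, 0 < u i) (hv : ∀ i, 0 < v i)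
    (huv : ∑ i, u i = ∑ i, v i)
    (huinf : ∀ i, |u i - d| ≤ d / 3)
    (hvinf : ∀ i, |v i - d| ≤ d / 3)
    (hu2 : Real.sqrt (∑ i, (u i - d) ^ 2) ≤ δ * Real.sqrt m)
    (hv2 : Real.sqrt (∑ i, (v i - d) ^ 2) ≤ δ * Real.sqrt m) :
    specNorm ((∑ i, u i)⁻¹ • Matrix.of (fun i j => v i * u j) -
        Matrix.of fun _ _ => d / m) ≤ 6 * δ := by
  refine specNorm_le_of_sum_sq_le _ (by positivity) ?_
  rcases Nat.eq_zero_or_pos m with rfl | hm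
  · simp only [univ_eq_empty, sum_empty]
    positivity
  have hm' : (0 : ℝ) < m := Nat.cast_pos.mpr hm
  have sq_bound {w : Fin m → ℝ} (hw : Real.sqrt (∑ i, (w i - d) ^ 2) ≤ δ * Real.sqrt m) :
      ∑ i, (w i - d) ^ 2 ≤ δ ^ 2 * m := by
    have := Real.sqrt_le_left (by positivity) |>.mp hw
    rwa [mul_pow, Real.sq_sqrt hm'.le] at this
  have hu2' := sq_bound hu2
  have hμ2 := (sum_sub_mean_sq_le hm' v d).trans (sq_bound hv2)
  rw [← huv] at hμ2
  have hS : m * (2 * d / 3) ≤ ∑ i, u i := by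
    have : ∑ _i : Fin m, 2 * d / 3 ≤ ∑ i, u i :=
      sum_le_sum fun i _ => by linarith [(abs_le.mp (huinf i)).1]
    simpa using this
  set S := ∑ i, u i
  have hS0 : 0 < S := lt_of_lt_of_le (by positivity) hS
  have entry_sq_le (i j : Fin m) :
      (S⁻¹ * (v i * u j) - d / m) ^ 2 ≤
        (S⁻¹) ^ 2 * (2 * ((4 * d / 3) ^ 2 * (u j - d) ^ 2 + d ^ 2 * (v i - S / m) ^ 2)) := by
    have h1 : S⁻¹ * (v i * u j) - d / m = S⁻¹ * (v i * (u j - d) + d * (v i - S / m)) := by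
      field_simp
      ring
    have h2 : v i ^ 2 ≤ (4 * d / 3) ^ 2 :=
      pow_le_pow_left₀ (hv i).le (by linarith [(abs_le.mp (hvinf i)).2]) 2
    rw [h1, mul_pow]
    gcongr
    refine add_sq_le.trans ?_
    rw [mul_pow, mul_pow]
    gcongr
  calc _ ≤ ∑ i, ∑ j,
        (S⁻¹) ^ 2 * (2 * ((4 * d / 3) ^ 2 * (u j - d) ^ 2 + d ^ 2 * (v i - S / m) ^ 2)) :=
        sum_le_sum fun i _ => sum_le_sum fun j _ => entry_sq_le i j
    _ = (S⁻¹) ^ 2 * (2 * (m * ((4 * d / 3) ^ 2 * ∑ j, (u j - d) ^ 2)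
          + m * (d ^ 2 * ∑ i, (v i - S / m) ^ 2))) := by
        simp only [← mul_sum, sum_add_distrib, sum_const, card_univ, Fintype.card_fin,
          nsmul_eq_mul]
        ring
    _ ≤ (S⁻¹) ^ 2 * (2 * (m * ((4 * d / 3) ^ 2 * (δ ^ 2 * m))
          + m * (d ^ 2 * (δ ^ 2 * m)))) := by gcongr
    _ = (S⁻¹) ^ 2 * (25 / 2 * δ ^ 2 * (m * (2 * d / 3)) ^ 2) := by ring
    _ ≤ (S⁻¹) ^ 2 * (25 / 2 * δ ^ 2 * S ^ 2) := by gcongr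
    _ = 25 / 2 * δ ^ 2 := by field_simp
    _ ≤ (6 * δ) ^ 2 := by nlinarith [sq_nonneg δ]
end
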